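/- Let n ≥ 2 and k ≥ 2 be integers, let 0 < T < ∞, and let l > n and 2 < q < ∞ satisfy n/l + 2/q = 1. There exists C > 0, depending only on n, k, l, q, with the following property: if u : ℝⁿ × [0,T] → ℝ^k is continuous with |u| ≡ 1, smooth on ℝⁿ × (0,T], solves the harmonic map heat flow ∂_t u = Δu + |∇u|² u on ℝⁿ × (0,T], and satisfies ‖∇u‖_{L^q_t L^l_x(ℝⁿ×[0,T])} < ∞, then there exists t₀ ∈ (0,T] such that sup_{0 < t ≤ t₀} √t ‖∇u(·,t)‖_{L^∞(ℝⁿ)} ≤ C ‖∇u‖_{L^q_t L^l_x(ℝⁿ×[0,t₀])}; moreover lim_{t→0⁺} √t ‖∇u(·,t)‖_{L^∞(ℝⁿ)} = 0. -/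

import Mathlib

open MeasureTheory Metric Set Filter Real ENNReal

noncomputable section

abbrev Sp (n : ℕ) := EuclideanSpace ℝ (Fin n)

/-- The `α`-th spatial coordinate direction in spacetime `ℝⁿ × ℝ`. -/
def sdir (n : ℕ) (α : Fin n) : Sp n × ℝ := (EuclideanSpace.single α 1, 0)

/-- The time direction in spacetime `ℝⁿ × ℝ`. -/
def tdir (n : ℕ) : Sp n × ℝ := (0, 1)

/-- Directional derivative of the `i`-th component of `u` in direction `v`. -/
def pd {n k : ℕ} (u : Sp n × ℝ → Fin k → ℝ) (i : Fin k) (v : Sp n × ℝ) (z : Sp n × ℝ) : ℝ :=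
  fderiv ℝ (fun w => u w i) z v

/-- Squared spatial gradient `|∇u|²`. -/
def gradSq {n k : ℕ} (u : Sp n × ℝ → Fin k → ℝ) (z : Sp n × ℝ) : ℝ :=
  ∑ α : Fin n, ∑ i : Fin k, (pd u i (sdir n α) z) ^ 2

/-- Squared time derivative `|∂ₜu|²`. -/
def dtSq {n k : ℕ} (u : Sp n × ℝ → Fin k → ℝ) (z : Sp n × ℝ) : ℝ :=
  ∑ i : Fin k, (pd u i (tdir n) z) ^ 2

/-- Spatial Laplacian `Δuⁱ`. -/
def lap {n k : ℕ} (u : Sp n × ℝ → Fin k → ℝ) (i : Fin k) (z : Sp n × ℝ) : ℝ :=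
  ∑ α : Fin n, fderiv ℝ (pd u i (sdir n α)) z (sdir n α)

/-- `u` takes values in the unit sphere `S^{k-1}` on `D`. -/
def SphereValued {n k : ℕ} (u : Sp n × ℝ → Fin k → ℝ) (D : Set (Sp n × ℝ)) : Prop :=
  ∀ z ∈ D, ∑ i : Fin k, (u z i) ^ 2 = 1

/-- `u` solves the harmonic map heat flow `∂ₜu = Δu + |∇u|² u` into the sphere on `D`. -/
def HeatFlow {n k : ℕ} (u : Sp n × ℝ → Fin k → ℝ) (D : Set (Sp n × ℝ)) : Prop :=
  ∀ z ∈ D, ∀ i : Fin k, pd u i (tdir n) z = lap u i z + gradSq u z * u z i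

/-- Parabolic cylinder `P_r(z₀) = closedBall(x₀,r) × (t₀ - r², t₀]`. -/
def pcyl {n : ℕ} (z₀ : Sp n × ℝ) (r : ℝ) : Set (Sp n × ℝ) :=
  closedBall z₀.1 r ×ˢ Ioc (z₀.2 - r ^ 2) z₀.2

/-- The mixed norm `‖∇u‖_{L^q_t L^l_x(ℝⁿ × (a,b])}` (as a value in `[0,∞]`). -/
def gradMixedNorm {n k : ℕ} (u : Sp n × ℝ → Fin k → ℝ) (a b l q : ℝ) : ℝ≥0∞ :=
  (∫⁻ t in Ioc a b,
      (∫⁻ x : Sp n, ENNReal.ofReal ((gradSq u (x, t)) ^ (l / 2))) ^ (q / l)) ^ (1 / q)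

section Calculus

variable {V : Type*} [NormedAddCommGroup V] [NormedSpace ℝ V]

/-- Directional derivative of a scalar function in a fixed direction. -/
def dd (v : V) (f : V → ℝ) (z : V) : ℝ := fderiv ℝ f z v

variable {Ω : Set V} {f g : V → ℝ} {z v w : V}

lemma contDiffOn_dd (hΩ : IsOpen Ω) (hf : ContDiffOn ℝ (⊤ : ℕ∞) f Ω) (v : V) :
    ContDiffOn ℝ (⊤ : ℕ∞) (dd v f) Ω :=
  (hf.fderiv_of_isOpen hΩ (by simp)).clm_apply contDiffOn_const

lemma differentiableAt_of_smooth (hΩ : IsOpen Ω) (hf : ContDiffOn ℝ (⊤ : ℕ∞) f Ω) (hz : z ∈ Ω) :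
    DifferentiableAt ℝ f z :=
  (hf.contDiffAt (hΩ.mem_nhds hz)).differentiableAt (by simp)

lemma dd_congr (hΩ : IsOpen Ω) (h : ∀ z ∈ Ω, f z = g z) (hz : z ∈ Ω) : dd v f z = dd v g z := by
  have : f =ᶠ[nhds z] g := Filter.eventually_of_mem (hΩ.mem_nhds hz) h
  simp only [dd, this.fderiv_eq]

lemma dd_comm (hΩ : IsOpen Ω) (hf : ContDiffOn ℝ (⊤ : ℕ∞) f Ω) (hz : z ∈ Ω) (v w : V) :
    dd v (dd w f) z = dd w (dd v f) z := by
  have hc := hf.contDiffAt (hΩ.mem_nhds hz)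
  have hd : DifferentiableAt ℝ (fderiv ℝ f) z :=
    (hc.fderiv_right (m := 1) (WithTop.coe_le_coe.2 (le_top : (2 : ℕ∞) ≤ ⊤))).differentiableAt
      (by simp)
  have key : ∀ a b : V, dd a (dd b f) z = fderiv ℝ (fderiv ℝ f) z a b := by
    intro a b
    have := (hd.hasFDerivAt.clm_apply (hasFDerivAt_const b z)).fderiv
    simp [dd, this, show dd b f = fun y => fderiv ℝ f y b from rfl]
  rw [key, key]
  exact (hc.isSymmSndFDerivAt (by simpa using WithTop.coe_le_coe.2 (le_top : (2 : ℕ∞) ≤ ⊤))) v w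

lemma dd_add (hf : DifferentiableAt ℝ f z) (hg : DifferentiableAt ℝ g z) :
    dd v (fun y => f y + g y) z = dd v f z + dd v g z := by
  simp [dd, fderiv_fun_add hf hg]

lemma dd_mul (hf : DifferentiableAt ℝ f z) (hg : DifferentiableAt ℝ g z) :
    dd v (fun y => f y * g y) z = f z * dd v g z + g z * dd v f z := by
  simp [dd, fderiv_fun_mul hf hg]

lemma dd_sum {ι : Type*} (s : Finset ι) {F : ι → V → ℝ} (hF : ∀ i, DifferentiableAt ℝ (F i) z) :
    dd v (fun y => ∑ i ∈ s, F i y) z = ∑ i ∈ s, dd v (F i) z := by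
  simp [dd, fderiv_fun_sum (fun i _ => hF i)]

lemma dd_const (c : ℝ) : dd v (fun _ => c) z = 0 := by simp [dd]

lemma dd_const_mul (c : ℝ) (hf : DifferentiableAt ℝ f z) :
    dd v (fun y => c * f y) z = c * dd v f z := by
  simp [dd, fderiv_const_mul hf]

lemma dd_eq_deriv (hf : DifferentiableAt ℝ f z) :
    dd v f z = deriv (fun s : ℝ => f (z + s • v)) 0 := by
  have h1 : HasDerivAt (fun s : ℝ => z + s • v) v 0 := by
    simpa using ((hasDerivAt_id (0 : ℝ)).smul_const v).const_add z
  have h2 : HasFDerivAt f (fderiv ℝ f z) (z + (0 : ℝ) • v) := by simpa using hf.hasFDerivAt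
  exact (h2.comp_hasDerivAt 0 h1).deriv.symm

lemma dd_dd_nonpos_of_isLocalMax (hΩ : IsOpen Ω) (hf : ContDiffOn ℝ (⊤ : ℕ∞) f Ω) (hz : z ∈ Ω)
    (hm : ∀ᶠ s : ℝ in nhds 0, f (z + s • v) ≤ f z) : dd v (dd v f) z ≤ 0 := by
  set γ : ℝ → ℝ := fun s => f (z + s • v) with hγ
  have hcont : Continuous fun s : ℝ => z + s • v := by fun_prop
  have hev : ∀ᶠ s : ℝ in nhds 0, z + s • v ∈ Ω :=
    hcont.continuousAt.eventually_mem (by simpa using hΩ.mem_nhds hz)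
  have hder : deriv γ =ᶠ[nhds 0] fun s => dd v f (z + s • v) := by
    filter_upwards [hev] with s hs
    have h1 : HasDerivAt (fun s : ℝ => z + s • v) v s := by
      simpa using ((hasDerivAt_id s).smul_const v).const_add z
    exact ((differentiableAt_of_smooth hΩ hf hs).hasFDerivAt.comp_hasDerivAt s h1).deriv
  have h2 : deriv (deriv γ) 0 = dd v (dd v f) z := by
    rw [hder.deriv_eq, dd_eq_deriv (differentiableAt_of_smooth hΩ (contDiffOn_dd hΩ hf v) hz)]
  have hmax : IsLocalMax γ 0 := by
    filter_upwards [hm] with s hs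
    simpa [hγ] using hs
  by_contra! hpos
  have hγc : ContinuousAt γ 0 := by
    refine ContinuousAt.comp (g := f) ?_ hcont.continuousAt
    simpa using (differentiableAt_of_smooth hΩ hf hz).continuousAt
  have hmin := isLocalMin_of_deriv_deriv_pos (by rw [h2]; exact hpos) hmax.deriv_eq_zero hγc
  have hconst : γ =ᶠ[nhds 0] fun _ => γ 0 := by
    filter_upwards [hmax, hmin] with s h1 h2 using le_antisymm h1 h2
  have : deriv (deriv γ) 0 = 0 := by
    rw [hconst.deriv.deriv_eq]; simp
  rw [h2] at this
  exact hpos.ne' this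

lemma dd_nonneg_of_max_past (hf : DifferentiableAt ℝ f z)
    (hm : ∀ᶠ s : ℝ in nhdsWithin 0 (Iio 0), f (z + s • v) ≤ f z) : 0 ≤ dd v f z := by
  have h1 : HasDerivAt (fun s : ℝ => z + s • v) v 0 := by
    simpa using ((hasDerivAt_id (0 : ℝ)).smul_const v).const_add z
  have h2 : HasFDerivAt f (fderiv ℝ f z) (z + (0 : ℝ) • v) := by simpa using hf.hasFDerivAt
  have h3 := (h2.comp_hasDerivAt 0 h1).hasDerivWithinAt (s := Iio 0)
  rw [hasDerivWithinAt_iff_tendsto_slope' (by simp)] at h3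
  refine ge_of_tendsto h3 ?_
  filter_upwards [hm, self_mem_nhdsWithin] with s hs hs0
  simp only [slope_def_field, Function.comp]
  refine div_nonneg_of_nonpos ?_ ?_
  · simpa using hs
  · simpa using le_of_lt hs0

end Calculus

section HeatOperator

variable {n : ℕ} {Ω : Set (Sp n × ℝ)} {f g : Sp n × ℝ → ℝ} {z : Sp n × ℝ}

/-- The heat operator `∂ₜ - Δ`. -/
def heatOp (f : Sp n × ℝ → ℝ) (z : Sp n × ℝ) : ℝ :=
  dd (tdir n) f z - ∑ α, dd (sdir n α) (dd (sdir n α) f) z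

lemma heatOp_nonneg_of_max (hΩ : IsOpen Ω) (hf : ContDiffOn ℝ (⊤ : ℕ∞) f Ω) (hz : z ∈ Ω)
    {x₁ : Sp n} {ρ a b : ℝ} (hx : dist z.1 x₁ < ρ) (ha : a < z.2) (hb : z.2 ≤ b)
    (hm : ∀ y ∈ closedBall x₁ ρ ×ˢ Icc a b, f y ≤ f z) : 0 ≤ heatOp f z := by
  have ht : 0 ≤ dd (tdir n) f z := by
    refine dd_nonneg_of_max_past (differentiableAt_of_smooth hΩ hf hz) ?_
    have : ∀ᶠ s : ℝ in nhdsWithin 0 (Iio 0), a - z.2 < s :=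
      mem_nhdsWithin_of_mem_nhds (Ioi_mem_nhds (by linarith))
    filter_upwards [this, self_mem_nhdsWithin] with s hs hs0
    refine hm _ ⟨by simpa [tdir] using hx.le, ?_⟩
    have : s < 0 := hs0
    simp only [tdir, Prod.snd_add, Prod.smul_snd, smul_eq_mul, mul_one, mem_Icc]
    constructor <;> linarith
  have hs : ∀ α, dd (sdir n α) (dd (sdir n α) f) z ≤ 0 := by
    intro α
    refine dd_dd_nonpos_of_isLocalMax hΩ hf hz ?_
    have hcont : Continuous fun s : ℝ => dist (z.1 + s • (EuclideanSpace.single α (1 : ℝ))) x₁ := by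
      fun_prop
    have : ∀ᶠ s : ℝ in nhds 0, dist (z.1 + s • (EuclideanSpace.single α (1 : ℝ))) x₁ < ρ :=
      hcont.continuousAt.eventually_lt continuousAt_const (by simpa using hx)
    filter_upwards [this] with s hs
    refine hm _ ⟨by simpa [sdir] using hs.le, ?_⟩
    simp only [sdir, Prod.snd_add, Prod.smul_snd, smul_zero, add_zero, mem_Icc]
    exact ⟨ha.le, hb⟩
  have := Finset.sum_nonpos fun α (_ : α ∈ Finset.univ) => hs α
  unfold heatOp
  linarith

lemma le_of_heatOp_neg (hΩ : IsOpen Ω) (hf : ContDiffOn ℝ (⊤ : ℕ∞) f Ω)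
    {x₁ : Sp n} {ρ a b B : ℝ} (hK : closedBall x₁ ρ ×ˢ Icc a b ⊆ Ω)
    (hbot : ∀ x ∈ closedBall x₁ ρ, f (x, a) ≤ B)
    (hlat : ∀ x, dist x x₁ = ρ → ∀ t ∈ Icc a b, f (x, t) ≤ B)
    (hint : ∀ y ∈ closedBall x₁ ρ ×ˢ Icc a b, B < f y → heatOp f y < 0) :
    ∀ y ∈ closedBall x₁ ρ ×ˢ Icc a b, f y ≤ B := by
  intro y hy
  obtain ⟨z, hzK, hz⟩ := ((isCompact_closedBall x₁ ρ).prod isCompact_Icc).exists_isMaxOn ⟨y, hy⟩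
    (hf.continuousOn.mono hK)
  by_contra! hlt
  have hBz : B < f z := hlt.trans_le (hz hy)
  have hneg := hint z hzK hBz
  obtain ⟨hz1, hz2, hz3⟩ := hzK
  have ha : a < z.2 := by
    refine lt_of_le_of_ne hz2 fun h => ?_
    have := hbot z.1 hz1
    rw [h] at this
    exact absurd this (not_le.2 hBz)
  have hx : dist z.1 x₁ < ρ :=
    lt_of_le_of_ne hz1 fun h => absurd (hlat z.1 h z.2 ⟨hz2, hz3⟩) (not_le.2 hBz)
  exact absurd (heatOp_nonneg_of_max hΩ hf (hK ⟨hz1, hz2, hz3⟩) hx ha hz3 fun y hy => hz hy)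
    (not_le.2 hneg)

lemma heatOp_add (hΩ : IsOpen Ω) (hf : ContDiffOn ℝ (⊤ : ℕ∞) f Ω)
    (hg : ContDiffOn ℝ (⊤ : ℕ∞) g Ω) (hz : z ∈ Ω) :
    heatOp (fun y => f y + g y) z = heatOp f z + heatOp g z := by
  have h1 : ∀ v, ∀ y ∈ Ω, dd v (fun y => f y + g y) y = dd v f y + dd v g y := fun v y hy =>
    dd_add (differentiableAt_of_smooth hΩ hf hy) (differentiableAt_of_smooth hΩ hg hy)
  have h2 : ∀ v, dd v (dd v (fun y => f y + g y)) z = dd v (dd v f) z + dd v (dd v g) z := by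
    intro v
    rw [dd_congr hΩ (h1 v) hz]
    exact dd_add (differentiableAt_of_smooth hΩ (contDiffOn_dd hΩ hf v) hz)
      (differentiableAt_of_smooth hΩ (contDiffOn_dd hΩ hg v) hz)
  simp only [heatOp, h1 _ z hz, h2, Finset.sum_add_distrib]
  ring

lemma heatOp_mul (hΩ : IsOpen Ω) (hf : ContDiffOn ℝ (⊤ : ℕ∞) f Ω)
    (hg : ContDiffOn ℝ (⊤ : ℕ∞) g Ω) (hz : z ∈ Ω) :
    heatOp (fun y => f y * g y) z = f z * heatOp g z + g z * heatOp f z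
      - 2 * ∑ α, dd (sdir n α) f z * dd (sdir n α) g z := by
  have d : ∀ {f : Sp n × ℝ → ℝ}, ContDiffOn ℝ (⊤ : ℕ∞) f Ω → ∀ y ∈ Ω, DifferentiableAt ℝ f y :=
    fun hf y hy => differentiableAt_of_smooth hΩ hf hy
  have h1 : ∀ v, ∀ y ∈ Ω, dd v (fun y => f y * g y) y = f y * dd v g y + g y * dd v f y :=
    fun v y hy => dd_mul (d hf y hy) (d hg y hy)
  have h2 : ∀ v, dd v (dd v (fun y => f y * g y)) z =
      f z * dd v (dd v g) z + g z * dd v (dd v f) z + 2 * (dd v f z * dd v g z) := by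
    intro v
    have hf' := contDiffOn_dd hΩ hf v
    have hg' := contDiffOn_dd hΩ hg v
    rw [dd_congr hΩ (h1 v) hz, dd_add (d (hf.mul hg') z hz) (d (hg.mul hf') z hz),
      dd_mul (d hf z hz) (d hg' z hz), dd_mul (d hg z hz) (d hf' z hz)]
    ring
  simp only [heatOp, h1 _ z hz, h2, Finset.sum_add_distrib, ← Finset.mul_sum]
  ring

lemma heatOp_const (c : ℝ) : heatOp (fun _ : Sp n × ℝ => c) z = 0 := by
  have : ∀ v : Sp n × ℝ, dd v (fun _ : Sp n × ℝ => c) = fun _ => 0 := fun v => by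
    funext y; exact dd_const c
  simp [heatOp, this, dd_const]

lemma heatOp_const_mul (hΩ : IsOpen Ω) (c : ℝ) (hf : ContDiffOn ℝ (⊤ : ℕ∞) f Ω) (hz : z ∈ Ω) :
    heatOp (fun y => c * f y) z = c * heatOp f z := by
  rw [heatOp_mul hΩ contDiffOn_const hf hz, heatOp_const]
  simp [dd_const]

lemma heatOp_sum (hΩ : IsOpen Ω) {ι : Type*} (s : Finset ι) {F : ι → Sp n × ℝ → ℝ}
    (hF : ∀ i, ContDiffOn ℝ (⊤ : ℕ∞) (F i) Ω) (hz : z ∈ Ω) :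
    heatOp (fun y => ∑ i ∈ s, F i y) z = ∑ i ∈ s, heatOp (F i) z := by
  classical
  induction s using Finset.induction_on with
  | empty => simpa using heatOp_const 0
  | insert i s hi ih =>
    simp only [Finset.sum_insert hi]
    rw [heatOp_add hΩ (hF i) (ContDiffOn.sum fun i _ => hF i) hz, ih]

lemma heatOp_sq (hΩ : IsOpen Ω) (hf : ContDiffOn ℝ (⊤ : ℕ∞) f Ω) (hz : z ∈ Ω) :
    heatOp (fun y => f y ^ 2) z = 2 * f z * heatOp f z - 2 * ∑ α, dd (sdir n α) f z ^ 2 := by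
  simp only [pow_two]
  rw [heatOp_mul hΩ hf hf hz]
  ring

lemma heatOp_dd (hΩ : IsOpen Ω) (hf : ContDiffOn ℝ (⊤ : ℕ∞) f Ω) (hz : z ∈ Ω) (v : Sp n × ℝ) :
    heatOp (dd v f) z = dd v (heatOp f) z := by
  have d : ∀ {f : Sp n × ℝ → ℝ}, ContDiffOn ℝ (⊤ : ℕ∞) f Ω → DifferentiableAt ℝ f z :=
    fun hf => differentiableAt_of_smooth hΩ hf hz
  have hs : ∀ v, ContDiffOn ℝ (⊤ : ℕ∞) (dd v f) Ω := contDiffOn_dd hΩ hf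
  have e1 : heatOp f = fun y => dd (tdir n) f y
      + (-1) * ∑ α, dd (sdir n α) (dd (sdir n α) f) y := by
    funext y; unfold heatOp; ring
  have hs2 : ∀ α : Fin n, ContDiffOn ℝ (⊤ : ℕ∞) (dd (sdir n α) (dd (sdir n α) f)) Ω :=
    fun α => contDiffOn_dd hΩ (hs _) _
  have hs3 : ContDiffOn ℝ (⊤ : ℕ∞) (fun y => ∑ α, dd (sdir n α) (dd (sdir n α) f) y) Ω :=
    ContDiffOn.sum fun α _ => hs2 α
  rw [e1, dd_add (d (hs _)) ((d hs3).const_mul _), dd_const_mul _ (d hs3),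
    dd_sum _ fun α => d (hs2 α)]
  unfold heatOp
  rw [dd_comm hΩ hf hz]
  have : ∀ α, dd (sdir n α) (dd (sdir n α) (dd v f)) z
      = dd v (dd (sdir n α) (dd (sdir n α) f)) z := by
    intro α
    rw [dd_congr hΩ (fun y hy => dd_comm hΩ hf hy (sdir n α) v) hz, dd_comm hΩ (hs _) hz]
  simp only [this]
  ring

end HeatOperator

section Algebra

variable {ι κ : Type*} [Fintype ι] [Fintype κ]

lemma sum_sum_mul_sq_le (f g : κ → ι → ℝ) :
    (∑ a, ∑ i, f a i * g a i) ^ 2 ≤ (∑ a, ∑ i, f a i ^ 2) * ∑ a, ∑ i, g a i ^ 2 := by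
  have := Finset.sum_mul_sq_le_sq_mul_sq (Finset.univ : Finset (κ × ι))
    (fun q => f q.1 q.2) (fun q => g q.1 q.2)
  simpa only [Fintype.sum_prod_type] using this

lemma mul_le_of_sq_le {a b X Y Z : ℝ} (ha : a ^ 2 ≤ X) (hb : b ^ 2 ≤ Y) (hXY : X * Y ≤ Z ^ 2)
    (hZ : 0 ≤ Z) : a * b ≤ Z := by
  refine le_of_abs_le (abs_le_of_sq_le_sq ?_ hZ)
  calc (a * b) ^ 2 = a ^ 2 * b ^ 2 := by ring
    _ ≤ X * Y := mul_le_mul ha hb (sq_nonneg b) ((sq_nonneg a).trans ha)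
    _ ≤ Z ^ 2 := hXY

lemma single_le_sum' {f : κ → ℝ} (hf : ∀ a, 0 ≤ f a) (a : κ) : f a ≤ ∑ a, f a :=
  Finset.single_le_sum (fun i _ => hf i) (Finset.mem_univ a)

lemma hessian_reaction_aux {e h τ N A B C D P Q R S : ℝ} (e0 : 0 ≤ e) (h0 : 0 ≤ h) (t0 : 0 ≤ τ)
    (hN : 0 < N) (hS : S ≤ h) (hA : A ^ 2 ≤ e * h) (hB : B ^ 2 ≤ e * h) (hP : P ^ 2 ≤ e * h)
    (hQ : Q ^ 2 ≤ e * h) (hC : C ^ 2 ≤ h * h) (hD : D ^ 2 ≤ e * τ) (hR : R ^ 2 ≤ e * e) :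
    2 * e * S + 4 * (P * A) + 4 * (Q * B) + 4 * (R * C) + 4 * (R * D)
      ≤ τ / N ^ 2 + 4 * N ^ 2 * e ^ 3 + 14 * e * h := by
  have b1 := mul_le_mul_of_nonneg_left hS (by positivity : 0 ≤ 2 * e)
  have eh0 : 0 ≤ e * h := by positivity
  have b2 := mul_le_of_sq_le hP hA (le_of_eq (by ring : _ = (e * h) ^ 2)) eh0
  have b3 := mul_le_of_sq_le hQ hB (le_of_eq (by ring : _ = (e * h) ^ 2)) eh0
  have b4 := mul_le_of_sq_le hR hC (le_of_eq (by ring : _ = (e * h) ^ 2)) eh0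
  have b5 : R * D ≤ (τ / N ^ 2 + 4 * N ^ 2 * e ^ 3) / 4 := by
    refine mul_le_of_sq_le hR hD ?_ (by positivity)
    obtain ⟨σ, hσ⟩ : ∃ σ, σ = τ / N ^ 2 := ⟨_, rfl⟩
    have hN2 : τ = σ * N ^ 2 := by rw [hσ]; field_simp
    rw [← hσ, hN2]
    nlinarith [sq_nonneg (σ - 4 * N ^ 2 * e ^ 3)]
  linarith

/-- Bound for one component of the reaction terms in the evolution of the squared Hessian of a
sphere-valued heat flow. -/
lemma hessian_reaction_component_le (w : ι → ℝ) (p : ι → κ → ℝ) (H : ι → κ → κ → ℝ)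
    (T : ι → κ → κ → κ → ℝ) {N e h τ : ℝ} (hN : 0 < N)
    (e0 : 0 ≤ e) (h0 : 0 ≤ h) (t0 : 0 ≤ τ)
    (he : ∑ c, ∑ j, p j c ^ 2 ≤ e) (hH1 : ∀ b, ∑ a, ∑ i, H i a b ^ 2 ≤ h)
    (hT : ∀ b c, ∑ a, ∑ i, T i a b c ^ 2 ≤ τ)
    (hw : ∀ a b, ∑ i, w i * H i a b = -∑ i, p i a * p i b) (a b : κ) :
    ∑ i, 2 * H i a b * (e * H i a b
      + p i a * (∑ c, ∑ j, 2 * p j c * H j c b)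
      + (w i * (∑ c, ∑ j, (2 * (H j c b * H j c a) + 2 * (p j c * T j c a b)))
      + (∑ c, ∑ j, 2 * p j c * H j c a) * p i b))
      ≤ τ / N ^ 2 + 4 * N ^ 2 * e ^ 3 + 14 * e * h := by
  have hp : ∀ a, ∑ i, p i a ^ 2 ≤ e := fun a =>
    (single_le_sum' (f := fun a => ∑ i, p i a ^ 2)
      (fun a => Finset.sum_nonneg fun i _ => sq_nonneg _) a).trans he
  have hH : ∀ a b, ∑ i, H i a b ^ 2 ≤ h := fun a b =>
    (single_le_sum' (f := fun a => ∑ i, H i a b ^ 2)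
      (fun a => Finset.sum_nonneg fun i _ => sq_nonneg _) a).trans (hH1 b)
  have eb : ∀ b, (∑ c, ∑ j, p j c * H j c b) ^ 2 ≤ e * h := fun b =>
    (sum_sum_mul_sq_le (fun c j => p j c) (fun c j => H j c b)).trans
      (mul_le_mul he (hH1 b) (by positivity) e0)
  have pH : ∀ c, (∑ i, p i c * H i a b) ^ 2 ≤ e * h := fun c =>
    (Finset.sum_mul_sq_le_sq_mul_sq _ _ _).trans
      (mul_le_mul (hp c) (hH a b) (by positivity) e0)
  have HH : (∑ c, ∑ j, H j c b * H j c a) ^ 2 ≤ h * h :=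
    (sum_sum_mul_sq_le (fun c j => H j c b) (fun c j => H j c a)).trans
      (mul_le_mul (hH1 b) (hH1 a) (by positivity) h0)
  have pT : (∑ c, ∑ j, p j c * T j c a b) ^ 2 ≤ e * τ :=
    (sum_sum_mul_sq_le (fun c j => p j c) (fun c j => T j c a b)).trans
      (mul_le_mul he (hT a b) (by positivity) e0)
  have pp : (∑ i, w i * H i a b) ^ 2 ≤ e * e := by
    rw [hw, neg_sq]
    exact (Finset.sum_mul_sq_le_sq_mul_sq _ _ _).trans
      (mul_le_mul (hp a) (hp b) (by positivity) e0)
  refine le_trans (le_of_eq ?_)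
    (hessian_reaction_aux e0 h0 t0 hN (hH a b) (eb b) (eb a) (pH a) (pH b) HH pT pp)
  have e1 : ∀ b, ∑ c, ∑ j, 2 * p j c * H j c b = 2 * ∑ c, ∑ j, p j c * H j c b := by
    intro b; simp only [Finset.mul_sum, mul_assoc]
  have e2 : ∑ c, ∑ j, (2 * (H j c b * H j c a) + 2 * (p j c * T j c a b))
      = 2 * (∑ c, ∑ j, H j c b * H j c a) + 2 * ∑ c, ∑ j, p j c * T j c a b := by
    simp only [Finset.sum_add_distrib, Finset.mul_sum]
  rw [e1, e1, e2]
  generalize (∑ c, ∑ j, p j c * H j c b) = A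
  generalize (∑ c, ∑ j, p j c * H j c a) = B
  generalize (∑ c, ∑ j, H j c b * H j c a) = C
  generalize (∑ c, ∑ j, p j c * T j c a b) = D
  simp only [Finset.sum_mul, Finset.mul_sum, ← Finset.sum_add_distrib]
  refine Finset.sum_congr rfl fun i _ => ?_
  ring

/-- Bound for the reaction terms in the evolution of the squared Hessian of a sphere-valued heat
flow. -/
lemma hessian_reaction_le (w : ι → ℝ) (p : ι → κ → ℝ) (H : ι → κ → κ → ℝ)
    (T : ι → κ → κ → κ → ℝ) {N e h : ℝ} (hN : N = Fintype.card κ) (hN1 : 0 < N)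
    (he : e = ∑ c, ∑ j, p j c ^ 2) (hh : h = ∑ b, ∑ a, ∑ i, H i a b ^ 2)
    (hw : ∀ a b, ∑ i, w i * H i a b = -∑ i, p i a * p i b) :
    ∑ b, ∑ a, ∑ i, 2 * H i a b * (e * H i a b
      + p i a * (∑ c, ∑ j, 2 * p j c * H j c b)
      + (w i * (∑ c, ∑ j, (2 * (H j c b * H j c a) + 2 * (p j c * T j c a b)))
      + (∑ c, ∑ j, 2 * p j c * H j c a) * p i b))
    ≤ (∑ c, ∑ b, ∑ a, ∑ i, T i a b c ^ 2) + 4 * N ^ 4 * e ^ 3 + 14 * N ^ 2 * e * h := by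
  have e0 : 0 ≤ e := by rw [he]; positivity
  have h0 : 0 ≤ h := by
    rw [hh]
    exact Finset.sum_nonneg fun b _ => Finset.sum_nonneg fun a _ =>
      Finset.sum_nonneg fun i _ => sq_nonneg _
  obtain ⟨τ, hτ⟩ : ∃ τ, τ = ∑ c, ∑ b, ∑ a, ∑ i, T i a b c ^ 2 := ⟨_, rfl⟩
  have n1 : ∀ b c, 0 ≤ ∑ a, ∑ i, T i a b c ^ 2 := fun b c =>
    Finset.sum_nonneg fun a _ => Finset.sum_nonneg fun i _ => sq_nonneg _
  have n2 : ∀ c, 0 ≤ ∑ b, ∑ a, ∑ i, T i a b c ^ 2 := fun c =>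
    Finset.sum_nonneg fun b _ => n1 b c
  have t0 : 0 ≤ τ := hτ ▸ Finset.sum_nonneg fun c _ => n2 c
  have hT : ∀ b c, ∑ a, ∑ i, T i a b c ^ 2 ≤ τ := by
    intro b c
    rw [hτ]
    have h1 := single_le_sum' (f := fun b => ∑ a, ∑ i, T i a b c ^ 2) (fun b => n1 b c) b
    have h2 := single_le_sum' (f := fun c => ∑ b, ∑ a, ∑ i, T i a b c ^ 2) n2 c
    exact le_trans h1 h2
  have hH1 : ∀ b, ∑ a, ∑ i, H i a b ^ 2 ≤ h := fun b => by
    rw [hh]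
    exact single_le_sum' (f := fun b => ∑ a, ∑ i, H i a b ^ 2)
      (fun b => Finset.sum_nonneg fun a _ => Finset.sum_nonneg fun i _ => sq_nonneg _) b
  rw [← hτ]
  refine (Finset.sum_le_sum fun b _ => Finset.sum_le_sum fun a _ =>
    hessian_reaction_component_le w p H T hN1 e0 h0 t0 he.ge hH1 hT hw a b).trans (le_of_eq ?_)
  simp only [Finset.sum_const, Finset.card_univ, nsmul_eq_mul, ← hN]
  field_simp

end Algebra

section Evolution

variable {n k : ℕ} {Ω : Set (Sp n × ℝ)} {u : Sp n × ℝ → Fin k → ℝ} {z : Sp n × ℝ}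

/-- Second spatial derivatives of `u`. -/
def hess (u : Sp n × ℝ → Fin k → ℝ) (i : Fin k) (a b : Fin n) : Sp n × ℝ → ℝ :=
  dd (sdir n b) (pd u i (sdir n a))

/-- Squared norm of the spatial Hessian of `u`. -/
def hessSq (u : Sp n × ℝ → Fin k → ℝ) (z : Sp n × ℝ) : ℝ :=
  ∑ b, ∑ a, ∑ i, hess u i a b z ^ 2

/-- Squared norm of the third spatial derivatives of `u`. -/
def thirdSq (u : Sp n × ℝ → Fin k → ℝ) (z : Sp n × ℝ) : ℝ :=
  ∑ c, ∑ b, ∑ a, ∑ i, dd (sdir n c) (hess u i a b) z ^ 2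

/-- A smooth sphere-valued solution of the heat flow on an open set. -/
structure IsSmoothFlow (u : Sp n × ℝ → Fin k → ℝ) (Ω : Set (Sp n × ℝ)) : Prop where
  isOpen : IsOpen Ω
  smooth : ∀ i, ContDiffOn ℝ (⊤ : ℕ∞) (fun z => u z i) Ω
  sphere : ∀ z ∈ Ω, ∑ i, u z i ^ 2 = 1
  flow : ∀ z ∈ Ω, ∀ i, heatOp (fun z => u z i) z = gradSq u z * u z i

lemma hessSq_nonneg : 0 ≤ hessSq u z :=
  Finset.sum_nonneg fun _ _ => Finset.sum_nonneg fun _ _ => Finset.sum_nonneg fun _ _ => sq_nonneg _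

lemma gradSq_nonneg : 0 ≤ gradSq u z :=
  Finset.sum_nonneg fun _ _ => Finset.sum_nonneg fun _ _ => sq_nonneg _

namespace IsSmoothFlow

variable (hu : IsSmoothFlow u Ω)
include hu

lemma smooth_pd (i : Fin k) (a : Fin n) : ContDiffOn ℝ (⊤ : ℕ∞) (pd u i (sdir n a)) Ω :=
  contDiffOn_dd hu.isOpen (hu.smooth i) _

lemma smooth_hess (i : Fin k) (a b : Fin n) : ContDiffOn ℝ (⊤ : ℕ∞) (hess u i a b) Ω :=
  contDiffOn_dd hu.isOpen (hu.smooth_pd i a) _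

lemma smooth_gradSq : ContDiffOn ℝ (⊤ : ℕ∞) (gradSq u) Ω :=
  ContDiffOn.sum fun a _ => ContDiffOn.sum fun i _ => (hu.smooth_pd i a).pow 2

lemma smooth_hessSq : ContDiffOn ℝ (⊤ : ℕ∞) (hessSq u) Ω :=
  ContDiffOn.sum fun b _ => ContDiffOn.sum fun a _ => ContDiffOn.sum fun i _ =>
    (hu.smooth_hess i a b).pow 2

lemma diff {f : Sp n × ℝ → ℝ} (hf : ContDiffOn ℝ (⊤ : ℕ∞) f Ω) (hz : z ∈ Ω) :
    DifferentiableAt ℝ f z :=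
  differentiableAt_of_smooth hu.isOpen hf hz

lemma sum_mul_pd (hz : z ∈ Ω) (a : Fin n) : ∑ i, u z i * pd u i (sdir n a) z = 0 := by
  have h1 : dd (sdir n a) (fun y => ∑ i, u y i * u y i) z = 0 := by
    rw [dd_congr hu.isOpen (g := fun _ => 1) (fun y hy => by
      simpa only [pow_two] using hu.sphere y hy) hz, dd_const]
  have d := fun i => hu.diff (hu.smooth i) hz
  rw [dd_sum _ fun i => (d i).fun_mul (d i)] at h1
  simp only [dd_mul (d _) (d _)] at h1
  rw [Finset.sum_add_distrib] at h1
  change ∑ i, u z i * dd (sdir n a) (fun y => u y i) z = 0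
  linarith

lemma sum_mul_hess (hz : z ∈ Ω) (a b : Fin n) :
    ∑ i, u z i * hess u i a b z = -∑ i, pd u i (sdir n a) z * pd u i (sdir n b) z := by
  have h1 : dd (sdir n b) (fun y => ∑ i, u y i * pd u i (sdir n a) y) z = 0 := by
    rw [dd_congr hu.isOpen (g := fun _ => 0) (fun y hy => hu.sum_mul_pd hy a) hz, dd_const]
  have d := fun i => hu.diff (hu.smooth i) hz
  have d' := fun i => hu.diff (hu.smooth_pd i a) hz
  rw [dd_sum _ fun i => (d i).fun_mul (d' i)] at h1
  simp only [dd_mul (d _) (d' _)] at h1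
  rw [Finset.sum_add_distrib] at h1
  exact eq_neg_of_add_eq_zero_left h1

lemma dd_gradSq (hz : z ∈ Ω) (b : Fin n) :
    dd (sdir n b) (gradSq u) z = ∑ a, ∑ i, 2 * pd u i (sdir n a) z * hess u i a b z := by
  have d := fun i a => hu.diff (hu.smooth_pd i a) hz
  have e : gradSq u = fun y => ∑ a, ∑ i, pd u i (sdir n a) y * pd u i (sdir n a) y := by
    funext y; simp only [gradSq, pow_two]
  rw [e, dd_sum _ fun a => DifferentiableAt.fun_sum fun i _ => (d i a).fun_mul (d i a)]
  refine Finset.sum_congr rfl fun a _ => ?_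
  rw [dd_sum _ fun i => (d i a).fun_mul (d i a)]
  refine Finset.sum_congr rfl fun i _ => ?_
  rw [dd_mul (d i a) (d i a)]
  simp only [hess]
  ring

lemma dd_dd_gradSq (hz : z ∈ Ω) (a b : Fin n) :
    dd (sdir n b) (dd (sdir n a) (gradSq u)) z = ∑ c, ∑ j,
      (2 * (hess u j c b z * hess u j c a z)
        + 2 * (pd u j (sdir n c) z * dd (sdir n b) (hess u j c a) z)) := by
  have d := fun i a => hu.diff (hu.smooth_pd i a) hz
  have d' := fun i c => hu.diff (hu.smooth_hess i c a) hz
  have e := fun i c => ((d i c).const_mul 2).fun_mul (d' i c)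
  rw [dd_congr hu.isOpen (fun y hy => hu.dd_gradSq hy a) hz,
    dd_sum _ fun c => DifferentiableAt.fun_sum fun i _ => e i c]
  refine Finset.sum_congr rfl fun c _ => ?_
  rw [dd_sum _ fun i => e i c]
  refine Finset.sum_congr rfl fun i _ => ?_
  rw [dd_mul ((d i c).const_mul 2) (d' i c), dd_const_mul _ (d i c)]
  simp only [hess]
  ring

lemma heatOp_pd (hz : z ∈ Ω) (i : Fin k) (a : Fin n) :
    heatOp (pd u i (sdir n a)) z
      = gradSq u z * pd u i (sdir n a) z + u z i * dd (sdir n a) (gradSq u) z := by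
  change heatOp (dd (sdir n a) fun y => u y i) z = _
  rw [heatOp_dd hu.isOpen (hu.smooth i) hz,
    dd_congr hu.isOpen (fun y hy => hu.flow y hy i) hz,
    dd_mul (hu.diff hu.smooth_gradSq hz) (hu.diff (hu.smooth i) hz)]
  rfl

lemma heatOp_hess (hz : z ∈ Ω) (i : Fin k) (a b : Fin n) :
    heatOp (hess u i a b) z = gradSq u z * hess u i a b z
      + pd u i (sdir n a) z * dd (sdir n b) (gradSq u) z
      + (u z i * dd (sdir n b) (dd (sdir n a) (gradSq u)) z
      + dd (sdir n a) (gradSq u) z * pd u i (sdir n b) z) := by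
  have s1 := hu.smooth_gradSq
  have s2 := contDiffOn_dd hu.isOpen s1 (sdir n a)
  rw [hess, heatOp_dd hu.isOpen (hu.smooth_pd i a) hz,
    dd_congr hu.isOpen (fun y hy => hu.heatOp_pd hy i a) hz,
    dd_add (hu.diff (s1.mul (hu.smooth_pd i a)) hz) (hu.diff ((hu.smooth i).mul s2) hz),
    dd_mul (hu.diff s1 hz) (hu.diff (hu.smooth_pd i a) hz),
    dd_mul (hu.diff (hu.smooth i) hz) (hu.diff s2 hz)]
  rfl

/-- The Bochner formula for the energy density. -/
lemma heatOp_gradSq (hz : z ∈ Ω) :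
    heatOp (gradSq u) z = 2 * gradSq u z ^ 2 - 2 * hessSq u z := by
  have e : gradSq u = fun y => ∑ a, ∑ i, pd u i (sdir n a) y ^ 2 := rfl
  have h1 : heatOp (gradSq u) z = ∑ a, ∑ i, heatOp (fun y => pd u i (sdir n a) y ^ 2) z := by
    rw [e, heatOp_sum hu.isOpen _ (fun a => ContDiffOn.sum fun i _ => (hu.smooth_pd i a).pow 2) hz]
    exact Finset.sum_congr rfl fun a _ =>
      heatOp_sum hu.isOpen _ (fun i => (hu.smooth_pd i a).pow 2) hz
  have h2 : hessSq u z = ∑ a, ∑ i, ∑ b, hess u i a b z ^ 2 := by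
    unfold hessSq
    rw [Finset.sum_comm]
    exact Finset.sum_congr rfl fun a _ => Finset.sum_comm
  rw [h1, h2]
  have h3 : ∀ a, ∑ i, heatOp (fun y => pd u i (sdir n a) y ^ 2) z
      = 2 * gradSq u z * (∑ i, pd u i (sdir n a) z ^ 2)
        - 2 * ∑ i, ∑ b, hess u i a b z ^ 2 := by
    intro a
    have h4 : ∀ i, heatOp (fun y => pd u i (sdir n a) y ^ 2) z
        = 2 * gradSq u z * pd u i (sdir n a) z ^ 2
          + 2 * dd (sdir n a) (gradSq u) z * (u z i * pd u i (sdir n a) z)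
          - 2 * ∑ b, hess u i a b z ^ 2 := by
      intro i
      rw [heatOp_sq hu.isOpen (hu.smooth_pd i a) hz, hu.heatOp_pd hz]
      simp only [hess]
      ring
    simp only [h4, Finset.sum_sub_distrib, Finset.sum_add_distrib, ← Finset.mul_sum,
      hu.sum_mul_pd hz]
    ring
  simp only [h3, Finset.sum_sub_distrib, ← Finset.mul_sum]
  simp only [gradSq]
  ring

lemma heatOp_hessSq_le (hn : 0 < n) (hz : z ∈ Ω) :
    heatOp (hessSq u) z ≤ -thirdSq u z + 4 * (n : ℝ) ^ 4 * gradSq u z ^ 3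
      + 14 * (n : ℝ) ^ 2 * gradSq u z * hessSq u z := by
  have s : ∀ b a i, ContDiffOn ℝ (⊤ : ℕ∞) (fun y => hess u i a b y ^ 2) Ω :=
    fun b a i => (hu.smooth_hess i a b).pow 2
  have h1 : heatOp (hessSq u) z = ∑ b, ∑ a, ∑ i, heatOp (fun y => hess u i a b y ^ 2) z := by
    change heatOp (fun y => ∑ b, ∑ a, ∑ i, hess u i a b y ^ 2) z = _
    rw [heatOp_sum hu.isOpen _
      (fun b => ContDiffOn.sum fun a _ => ContDiffOn.sum fun i _ => s b a i) hz]
    refine Finset.sum_congr rfl fun b _ => ?_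
    rw [heatOp_sum hu.isOpen _ (fun a => ContDiffOn.sum fun i _ => s b a i) hz]
    exact Finset.sum_congr rfl fun a _ => heatOp_sum hu.isOpen _ (s b a) hz
  have h2 : thirdSq u z = ∑ b, ∑ a, ∑ i, ∑ c, dd (sdir n c) (hess u i a b) z ^ 2 := by
    unfold thirdSq
    rw [Finset.sum_comm]
    refine Finset.sum_congr rfl fun b _ => ?_
    rw [Finset.sum_comm]
    exact Finset.sum_congr rfl fun a _ => Finset.sum_comm
  have h3 : heatOp (hessSq u) z
      = (∑ b, ∑ a, ∑ i, 2 * hess u i a b z * heatOp (hess u i a b) z) - 2 * thirdSq u z := by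
    rw [h1, h2]
    simp only [Finset.mul_sum, ← Finset.sum_sub_distrib]
    refine Finset.sum_congr rfl fun b _ => Finset.sum_congr rfl fun a _ =>
      Finset.sum_congr rfl fun i _ => ?_
    rw [heatOp_sq hu.isOpen (hu.smooth_hess i a b) hz, Finset.mul_sum]
  have h4 := hessian_reaction_le (fun i => u z i) (fun i a => pd u i (sdir n a) z)
    (fun i a b => hess u i a b z) (fun i a b c => dd (sdir n c) (hess u i a b) z)
    (N := n) (e := gradSq u z) (h := hessSq u z) (by simp) (by exact_mod_cast hn) rfl rfl
    (fun a b => hu.sum_mul_hess hz a b)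
  simp only [← hu.dd_gradSq hz, ← hu.dd_dd_gradSq hz, ← hu.heatOp_hess hz] at h4
  change _ ≤ thirdSq u z + _ + _ at h4
  linarith

lemma dd_gradSq_sq_le (hz : z ∈ Ω) (b : Fin n) :
    dd (sdir n b) (gradSq u) z ^ 2 ≤ 4 * gradSq u z * hessSq u z := by
  have h1 : dd (sdir n b) (gradSq u) z
      = 2 * ∑ a, ∑ i, pd u i (sdir n a) z * hess u i a b z := by
    rw [hu.dd_gradSq hz]
    simp only [Finset.mul_sum, mul_assoc]
  have h2 := sum_sum_mul_sq_le (fun a i => pd u i (sdir n a) z) (fun a i => hess u i a b z)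
  have h3 : ∑ a, ∑ i, hess u i a b z ^ 2 ≤ hessSq u z :=
    single_le_sum' (f := fun b => ∑ a, ∑ i, hess u i a b z ^ 2)
      (fun b => Finset.sum_nonneg fun _ _ => Finset.sum_nonneg fun _ _ => sq_nonneg _) b
  have h4 := mul_le_mul_of_nonneg_left h3 (gradSq_nonneg (u := u) (z := z))
  have h5 : gradSq u z = ∑ a, ∑ i, pd u i (sdir n a) z ^ 2 := rfl
  rw [h1]
  rw [← h5] at h2
  nlinarith

end IsSmoothFlow

end Evolution

section Cutoff

variable {n : ℕ} {z v : Sp n × ℝ}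

/-- Squared spatial distance to `x₁`. -/
def distSq (x₁ : Sp n) (z : Sp n × ℝ) : ℝ := ∑ a, (z.1 a - x₁ a) ^ 2

lemma distSq_eq (x₁ : Sp n) (z : Sp n × ℝ) : distSq x₁ z = dist z.1 x₁ ^ 2 := by
  simp only [distSq, dist_eq_norm, EuclideanSpace.norm_sq_eq, PiLp.sub_apply, norm_eq_abs, sq_abs]

lemma contDiff_coord (x₁ : Sp n) (a : Fin n) :
    ContDiff ℝ (⊤ : ℕ∞) (fun z : Sp n × ℝ => z.1 a - x₁ a) :=
  ((EuclideanSpace.proj a : Sp n →L[ℝ] ℝ).comp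
    (ContinuousLinearMap.fst ℝ (Sp n) ℝ)).contDiff.sub contDiff_const

lemma dd_coord (x₁ : Sp n) (a : Fin n) : dd v (fun z : Sp n × ℝ => z.1 a - x₁ a) z = v.1 a := by
  have h := ((EuclideanSpace.proj a : Sp n →L[ℝ] ℝ).comp
    (ContinuousLinearMap.fst ℝ (Sp n) ℝ)).hasFDerivAt (x := z)
  have h' := (h.sub_const (x₁ a)).fderiv
  have h2 : fderiv ℝ (fun z : Sp n × ℝ => z.1 a - x₁ a) z
    = (EuclideanSpace.proj a : Sp n →L[ℝ] ℝ).comp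
    (ContinuousLinearMap.fst ℝ (Sp n) ℝ) := h'
  simp [dd, h2]

lemma contDiff_distSq (x₁ : Sp n) : ContDiff ℝ (⊤ : ℕ∞) (distSq x₁) :=
  ContDiff.sum fun a _ => (contDiff_coord x₁ a).pow 2

lemma dd_distSq (x₁ : Sp n) : dd v (distSq x₁) z = ∑ a, 2 * (z.1 a - x₁ a) * v.1 a := by
  have d : ∀ a, DifferentiableAt ℝ (fun z : Sp n × ℝ => z.1 a - x₁ a) z := fun a =>
    (contDiff_coord x₁ a).differentiable (by simp) z
  have e : distSq x₁ = fun z : Sp n × ℝ => ∑ a, (z.1 a - x₁ a) * (z.1 a - x₁ a) := by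
    funext y; simp only [distSq, pow_two]
  rw [e, dd_sum _ fun a => (d a).fun_mul (d a)]
  refine Finset.sum_congr rfl fun a _ => ?_
  rw [dd_mul (d a) (d a), dd_coord]
  ring

lemma dd_sdir_distSq (x₁ : Sp n) (b : Fin n) :
    dd (sdir n b) (distSq x₁) z = 2 * (z.1 b - x₁ b) := by
  rw [dd_distSq]
  simp [sdir]

lemma heatOp_distSq (x₁ : Sp n) : heatOp (distSq x₁) z = -(2 * n) := by
  have h1 : dd (tdir n) (distSq x₁) z = 0 := by rw [dd_distSq]; simp [tdir]
  have h2 : ∀ b, dd (sdir n b) (dd (sdir n b) (distSq x₁)) z = 2 := by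
    intro b
    have : dd (sdir n b) (distSq x₁) = fun y => 2 * (y.1 b - x₁ b) := by
      funext y; exact dd_sdir_distSq x₁ b
    rw [this, dd_const_mul _ ((contDiff_coord x₁ b).differentiable (by simp) z), dd_coord]
    simp [sdir]
  simp only [heatOp, h1, h2]
  simp
  ring

lemma contDiff_time : ContDiff ℝ (⊤ : ℕ∞) (fun z : Sp n × ℝ => z.2) := contDiff_snd

lemma dd_time : dd v (fun z : Sp n × ℝ => z.2) z = v.2 := by
  have : fderiv ℝ (fun z : Sp n × ℝ => z.2) z = ContinuousLinearMap.snd ℝ (Sp n) ℝ :=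
    (ContinuousLinearMap.snd ℝ (Sp n) ℝ).hasFDerivAt.fderiv
  simp [dd, this]

lemma heatOp_time : heatOp (fun z : Sp n × ℝ => z.2) z = 1 := by
  have : ∀ v : Sp n × ℝ, dd v (fun z : Sp n × ℝ => z.2) = fun _ => v.2 := fun v => by
    funext y; exact dd_time
  simp only [heatOp, this, dd_const]
  simp [tdir]

end Cutoff

section HessianEstimate

variable {n k : ℕ} {Ω : Set (Sp n × ℝ)} {u : Sp n × ℝ → Fin k → ℝ} {z : Sp n × ℝ}

/-- Constant in the interior Hessian estimate. -/
def hessConst (n : ℕ) : ℝ := 4 * (4 * (n : ℝ) ^ 4 + 4 * (14 * (n : ℝ) ^ 2 + 4 * n + 66))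

lemma hessConst_pos (n : ℕ) : 0 < hessConst n := by unfold hessConst; positivity

lemma bernstein_neg {N A σ E e h φ τ L : ℝ} (hN : 0 ≤ N) (hA : A = 14 * N ^ 2 + 4 * N + 66)
    (hE : 0 < E) (hEσ : E ≤ σ) (e0 : 0 ≤ e) (heE : e ≤ E) (h0 : 0 ≤ h) (φ1 : φ ≤ 1)
    (hL : L ≤ φ * (-τ + 4 * N ^ 4 * e ^ 3 + 14 * N ^ 2 * e * h) + h * ((1 + 4 * N) * σ)
      + (φ * τ + 64 * h * σ) + A * σ * (2 * e ^ 2 - 2 * h))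
    (hG : (4 * N ^ 4 + 4 * A) * E * σ < φ * h + A * σ * e) : L < 0 := by
  have hσ : 0 < σ := hE.trans_le hEσ
  have hA1 : 1 ≤ A := by rw [hA]; nlinarith [sq_nonneg N]
  have hA0 : 0 ≤ A * σ := by positivity
  have b1 : A * σ * e ≤ A * σ * E := mul_le_mul_of_nonneg_left heE hA0
  have b2 : φ * h ≤ h := mul_le_of_le_one_left h0 φ1
  have hh : (4 * N ^ 4 + 3 * A) * E * σ < h := by linarith
  have e2 : e ^ 2 ≤ E * σ := by
    rw [pow_two]; exact mul_le_mul heE (heE.trans hEσ) e0 hE.le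
  have e3 : e ^ 3 ≤ E * σ * σ := by
    have : e ^ 3 = e ^ 2 * e := by ring
    rw [this]; exact mul_le_mul e2 (heE.trans hEσ) e0 (by positivity)
  have c1 : φ * (4 * N ^ 4 * e ^ 3) ≤ 4 * N ^ 4 * (E * σ * σ) :=
    (mul_le_of_le_one_left (by positivity) φ1).trans
      (mul_le_mul_of_nonneg_left e3 (by positivity))
  have c2 : φ * (14 * N ^ 2 * e * h) ≤ 14 * N ^ 2 * σ * h :=
    (mul_le_of_le_one_left (by positivity) φ1).trans
      (mul_le_mul_of_nonneg_right (mul_le_mul_of_nonneg_left (heE.trans hEσ) (by positivity)) h0)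
  have c3 : A * σ * (2 * e ^ 2) ≤ A * σ * (2 * (E * σ)) :=
    mul_le_mul_of_nonneg_left (by linarith) hA0
  have c4 : L ≤ σ * ((4 * N ^ 4 + 2 * A) * E * σ - A * h) := by
    have : σ * ((4 * N ^ 4 + 2 * A) * E * σ - A * h)
      = 4 * N ^ 4 * (E * σ * σ) + A * σ * (2 * (E * σ)) + 14 * N ^ 2 * σ * h
        + h * ((1 + 4 * N) * σ) + 64 * h * σ - A * σ * (2 * h) + σ * h := by
      rw [hA]; ring
    have : 0 ≤ σ * h := by positivity
    linarith
  have c5 : h ≤ A * h := le_mul_of_one_le_left h0 hA1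
  have c6 : 0 < A * E * σ := by positivity
  exact c4.trans_lt (mul_neg_of_pos_of_neg hσ (by linarith))

/-- Interior Hessian estimate from a gradient bound. -/
lemma IsSmoothFlow.hessSq_le (hu : IsSmoothFlow u Ω) (hn : 0 < n) {x₁ : Sp n} {t₁ s E : ℝ}
    (hs : 0 < s) (hE : 0 < E) (hsE : s ^ 2 * E ≤ 1)
    (hK : closedBall x₁ s ×ˢ Icc (t₁ - s ^ 2) t₁ ⊆ Ω)
    (he : ∀ y ∈ closedBall x₁ s ×ˢ Icc (t₁ - s ^ 2) t₁, gradSq u y ≤ E) :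
    ∀ y ∈ closedBall x₁ (s / 2) ×ˢ Icc (t₁ - s ^ 2 / 4) t₁,
      hessSq u y ≤ hessConst n * E / s ^ 2 := by
  obtain ⟨N, hN⟩ : ∃ N : ℝ, N = n := ⟨_, rfl⟩
  have N0 : 0 ≤ N := hN ▸ Nat.cast_nonneg n
  obtain ⟨A, hA⟩ : ∃ A, A = 14 * N ^ 2 + 4 * N + 66 := ⟨_, rfl⟩
  have A0 : 0 < A := by rw [hA]; positivity
  obtain ⟨σ, hσ⟩ : ∃ σ, σ = 1 / s ^ 2 := ⟨_, rfl⟩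
  have σ0 : 0 < σ := by rw [hσ]; positivity
  have hσs : σ * s ^ 2 = 1 := by rw [hσ]; field_simp
  have hEσ : E ≤ σ := by
    rw [hσ, le_div_iff₀ (by positivity)]; linarith
  have ho := hu.isOpen
  set η : Sp n × ℝ → ℝ := fun y => 1 + (-σ) * distSq x₁ y with hη
  set θ : Sp n × ℝ → ℝ := fun y => (1 - σ * t₁) + σ * y.2 with hθ
  have sD : ContDiffOn ℝ (⊤ : ℕ∞) (distSq x₁) Ω := (contDiff_distSq x₁).contDiffOn
  have sT : ContDiffOn ℝ (⊤ : ℕ∞) (fun y : Sp n × ℝ => y.2) Ω := contDiff_time.contDiffOn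
  have sη : ContDiffOn ℝ (⊤ : ℕ∞) η Ω := contDiffOn_const.add (contDiffOn_const.mul sD)
  have sθ : ContDiffOn ℝ (⊤ : ℕ∞) θ Ω := contDiffOn_const.add (contDiffOn_const.mul sT)
  have sη2 : ContDiffOn ℝ (⊤ : ℕ∞) (fun y => η y ^ 2) Ω := sη.pow 2
  have sφ : ContDiffOn ℝ (⊤ : ℕ∞) (fun y => η y ^ 2 * θ y) Ω := sη2.mul sθ
  have sh := hu.smooth_hessSq
  have sφh : ContDiffOn ℝ (⊤ : ℕ∞) (fun y => η y ^ 2 * θ y * hessSq u y) Ω := sφ.mul sh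
  have sAe : ContDiffOn ℝ (⊤ : ℕ∞) (fun y => A * σ * gradSq u y) Ω :=
    contDiffOn_const.mul hu.smooth_gradSq
  have hη01 : ∀ y ∈ closedBall x₁ s ×ˢ Icc (t₁ - s ^ 2) t₁, 0 ≤ η y ∧ η y ≤ 1 := by
    rintro y ⟨hy, -⟩
    have h1 : distSq x₁ y ≤ s ^ 2 := by
      rw [distSq_eq]; exact pow_le_pow_left₀ dist_nonneg hy 2
    have h0 : 0 ≤ distSq x₁ y := by rw [distSq_eq]; positivity
    have := mul_le_mul_of_nonneg_left h1 σ0.le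
    have := mul_nonneg σ0.le h0
    constructor <;> simp only [hη] <;> linarith
  have hθ01 : ∀ y ∈ closedBall x₁ s ×ˢ Icc (t₁ - s ^ 2) t₁, 0 ≤ θ y ∧ θ y ≤ 1 := by
    rintro y ⟨-, hy1, hy2⟩
    have := mul_le_mul_of_nonneg_left hy1 σ0.le
    have := mul_le_mul_of_nonneg_left hy2 σ0.le
    constructor <;> simp only [hθ] <;> linarith
  have main := le_of_heatOp_neg (f := fun y => η y ^ 2 * θ y * hessSq u y + A * σ * gradSq u y)
    (B := (4 * N ^ 4 + 4 * A) * E * σ) ho (sφh.add sAe) hK ?_ ?_ ?_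
  · intro y hy
    have hyK : y ∈ closedBall x₁ s ×ˢ Icc (t₁ - s ^ 2) t₁ :=
      ⟨closedBall_subset_closedBall (by linarith) hy.1,
        Icc_subset_Icc (by nlinarith) le_rfl hy.2⟩
    have h1 := main y hyK
    have h2 : 3 / 4 ≤ η y := by
      have h1 : distSq x₁ y ≤ (s / 2) ^ 2 := by
        rw [distSq_eq]; exact pow_le_pow_left₀ dist_nonneg hy.1 2
      have := mul_le_mul_of_nonneg_left h1 σ0.le
      simp only [hη]; linarith
    have h3 : 3 / 4 ≤ θ y := by
      have := mul_le_mul_of_nonneg_left hy.2.1 σ0.le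
      simp only [hθ]; linarith
    have h4 : 1 / 4 ≤ η y ^ 2 * θ y := by nlinarith
    have h5 := mul_le_mul_of_nonneg_right h4 (hessSq_nonneg (u := u) (z := y))
    have h6 : 0 ≤ A * σ * gradSq u y := mul_nonneg (by positivity) gradSq_nonneg
    have h7 : hessConst n * E / s ^ 2 = 4 * ((4 * N ^ 4 + 4 * A) * E * σ) := by
      rw [hessConst, hA, hσ, hN]; ring
    rw [h7]
    linarith
  · intro x hx
    have hb : θ (x, t₁ - s ^ 2) = 0 := by simp only [hθ]; linarith
    have h1 := he (x, t₁ - s ^ 2) ⟨hx, le_rfl, by simp; positivity⟩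
    have h2 := mul_le_mul_of_nonneg_left h1 (by positivity : 0 ≤ A * σ)
    rw [hb]
    have : 0 ≤ (4 * N ^ 4 + 3 * A) * E * σ := by positivity
    linarith
  · intro x hx t ht
    have hb : η (x, t) = 0 := by simp only [hη, distSq_eq, hx]; linarith
    have h1 := he (x, t) ⟨hx.le, ht⟩
    have h2 := mul_le_mul_of_nonneg_left h1 (by positivity : 0 ≤ A * σ)
    rw [hb]
    have : 0 ≤ (4 * N ^ 4 + 3 * A) * E * σ := by positivity
    linarith
  · intro y hyK hG
    have hyΩ := hK hyK
    obtain ⟨η0, η1⟩ := hη01 y hyK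
    obtain ⟨θ0, θ1⟩ := hθ01 y hyK
    have dη : ∀ c, dd (sdir n c) η y = -σ * (2 * (y.1 c - x₁ c)) := by
      intro c
      have d := hu.diff sD hyΩ
      rw [hη, dd_add (differentiableAt_const _) (d.const_mul _), dd_const, dd_const_mul _ d,
        dd_sdir_distSq, zero_add]
    have dθ : ∀ c, dd (sdir n c) θ y = 0 := by
      intro c
      have d := hu.diff sT hyΩ
      rw [hθ, dd_add (differentiableAt_const _) (d.const_mul _), dd_const, dd_const_mul _ d,
        dd_time]
      simp [sdir]
    have Lη : heatOp η y = σ * (2 * N) := by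
      rw [hη, heatOp_add ho contDiffOn_const (contDiffOn_const.mul sD) hyΩ, heatOp_const,
        heatOp_const_mul ho _ sD hyΩ, heatOp_distSq, hN]
      ring
    have Lθ : heatOp θ y = σ := by
      rw [hθ, heatOp_add ho contDiffOn_const (contDiffOn_const.mul sT) hyΩ, heatOp_const,
        heatOp_const_mul ho _ sT hyΩ, heatOp_time]
      ring
    have dη2 : ∀ c, dd (sdir n c) (fun y => η y ^ 2) y = 2 * η y * dd (sdir n c) η y := by
      intro c
      simp only [pow_two]
      rw [dd_mul (hu.diff sη hyΩ) (hu.diff sη hyΩ)]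
      ring
    have dφ : ∀ c, dd (sdir n c) (fun y => η y ^ 2 * θ y) y
        = 2 * η y * θ y * dd (sdir n c) η y := by
      intro c
      rw [dd_mul (hu.diff sη2 hyΩ) (hu.diff sθ hyΩ), dθ, dη2]
      ring
    have Sη : ∑ c, dd (sdir n c) η y ^ 2 ≤ 4 * σ := by
      have h1 : ∑ c, dd (sdir n c) η y ^ 2 = 4 * σ ^ 2 * distSq x₁ y := by
        simp only [dη, distSq, Finset.mul_sum]
        exact Finset.sum_congr rfl fun c _ => by ring
      have h2 : distSq x₁ y ≤ s ^ 2 := by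
        rw [distSq_eq]; exact pow_le_pow_left₀ dist_nonneg hyK.1 2
      have h3 := mul_le_mul_of_nonneg_left h2 (by positivity : 0 ≤ 4 * σ ^ 2)
      rw [h1]
      calc _ ≤ _ := h3
        _ = 4 * σ * (σ * s ^ 2) := by ring
        _ = 4 * σ := by rw [hσs, mul_one]
    have Sη0 : 0 ≤ ∑ c, dd (sdir n c) η y ^ 2 := Finset.sum_nonneg fun c _ => sq_nonneg _
    have Lφ : heatOp (fun y => η y ^ 2 * θ y) y ≤ (1 + 4 * N) * σ := by
      rw [heatOp_mul ho sη2 sθ hyΩ, heatOp_sq ho sη hyΩ, Lθ, Lη]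
      simp only [dθ, mul_zero, Finset.sum_const_zero, sub_zero]
      have h1 : η y ^ 2 * σ ≤ σ := mul_le_of_le_one_left σ0.le (pow_le_one₀ η0 η1)
      have h2 : θ y * η y * (4 * N * σ) ≤ 4 * N * σ :=
        mul_le_of_le_one_left (by positivity) (mul_le_one₀ θ1 η0 η1)
      have h3 := mul_nonneg θ0 Sη0
      linarith
    have dh : ∀ c, dd (sdir n c) (hessSq u) y
        = ∑ b, ∑ a, ∑ i, 2 * hess u i a b y * dd (sdir n c) (hess u i a b) y := by
      intro c
      have d := fun i a b => hu.diff (hu.smooth_hess i a b) hyΩ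
      have e : hessSq u = fun y => ∑ b, ∑ a, ∑ i, hess u i a b y * hess u i a b y := by
        funext y; simp only [hessSq, pow_two]
      rw [e, dd_sum _ fun b => DifferentiableAt.fun_sum fun a _ =>
        DifferentiableAt.fun_sum fun i _ => (d i a b).fun_mul (d i a b)]
      refine Finset.sum_congr rfl fun b _ => ?_
      rw [dd_sum _ fun a => DifferentiableAt.fun_sum fun i _ => (d i a b).fun_mul (d i a b)]
      refine Finset.sum_congr rfl fun a _ => ?_
      rw [dd_sum _ fun i => (d i a b).fun_mul (d i a b)]
      refine Finset.sum_congr rfl fun i _ => ?_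
      rw [dd_mul (d i a b) (d i a b)]
      ring
    have cross : -(2 * ∑ c, dd (sdir n c) (fun y => η y ^ 2 * θ y) y * dd (sdir n c) (hessSq u) y)
        ≤ η y ^ 2 * θ y * thirdSq u y + 64 * hessSq u y * σ := by
      have h1 : ∀ c, -(2 * (dd (sdir n c) (fun y => η y ^ 2 * θ y) y
            * dd (sdir n c) (hessSq u) y))
          ≤ η y ^ 2 * θ y * (∑ b, ∑ a, ∑ i, dd (sdir n c) (hess u i a b) y ^ 2)
            + 16 * θ y * hessSq u y * dd (sdir n c) η y ^ 2 := by
        intro c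
        rw [dφ, dh, hessSq]
        generalize dd (sdir n c) η y = ξ
        simp only [Finset.mul_sum, Finset.sum_mul, ← Finset.sum_neg_distrib,
          ← Finset.sum_add_distrib]
        refine Finset.sum_le_sum fun b _ => Finset.sum_le_sum fun a _ =>
          Finset.sum_le_sum fun i _ => ?_
        have := mul_nonneg θ0 (sq_nonneg (η y * dd (sdir n c) (hess u i a b) y
          + 4 * ξ * hess u i a b y))
        linarith
      have h2 := Finset.sum_le_sum fun c (_ : c ∈ Finset.univ) => h1 c
      rw [Finset.sum_neg_distrib, Finset.sum_add_distrib, ← Finset.mul_sum, ← Finset.mul_sum,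
        ← Finset.mul_sum] at h2
      have h3 : 16 * θ y * hessSq u y * ∑ c, dd (sdir n c) η y ^ 2
          ≤ 16 * 1 * hessSq u y * (4 * σ) := by
        have hh := hessSq_nonneg (u := u) (z := y)
        gcongr
      rw [thirdSq]
      linarith
    have LG : heatOp (fun y => η y ^ 2 * θ y * hessSq u y + A * σ * gradSq u y) y
        = η y ^ 2 * θ y * heatOp (hessSq u) y
          + hessSq u y * heatOp (fun y => η y ^ 2 * θ y) y
          + -(2 * ∑ c, dd (sdir n c) (fun y => η y ^ 2 * θ y) y * dd (sdir n c) (hessSq u) y)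
          + A * σ * (2 * gradSq u y ^ 2 - 2 * hessSq u y) := by
      rw [heatOp_add ho sφh sAe hyΩ, heatOp_const_mul ho _ hu.smooth_gradSq hyΩ,
        hu.heatOp_gradSq hyΩ, heatOp_mul ho sφ sh hyΩ]
      ring
    have φ0 : 0 ≤ η y ^ 2 * θ y := by positivity
    refine bernstein_neg (φ := η y ^ 2 * θ y) (τ := thirdSq u y) N0 hA hE hEσ gradSq_nonneg
      (he y hyK) hessSq_nonneg (mul_le_one₀ (pow_le_one₀ η0 η1) θ0 θ1) ?_ hG
    rw [LG]
    have t1 := mul_le_mul_of_nonneg_left (hu.heatOp_hessSq_le hn hyΩ) φ0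
    have t2 := mul_le_mul_of_nonneg_left Lφ (hessSq_nonneg (u := u) (z := y))
    rw [← hN] at t1
    linarith

end HessianEstimate

section Concentration

variable {n k : ℕ} {Ω : Set (Sp n × ℝ)} {u : Sp n × ℝ → Fin k → ℝ}

/-- Constant in the spatial Lipschitz estimate for the energy density. -/
def lipConst (n : ℕ) : ℝ := 1 + n * (2 * √(hessConst n))

lemma one_le_lipConst (n : ℕ) : 1 ≤ lipConst n := by
  unfold lipConst
  have : 0 ≤ n * (2 * √(hessConst n)) := by positivity
  linarith

lemma inl_eq_sum (v : Sp n) : ((v, 0) : Sp n × ℝ) = ∑ a, v a • sdir n a := by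
  refine Prod.ext ?_ ?_
  · rw [Prod.fst_sum]
    simp only [sdir, Prod.smul_fst]
    ext b
    simp [Pi.single_apply]
  · simp [Prod.snd_sum, sdir]

lemma norm_fderiv_inl_le {f : Sp n × ℝ → ℝ} {z : Sp n × ℝ} {M : ℝ} (hM : 0 ≤ M)
    (h : ∀ a, |dd (sdir n a) f z| ≤ M) :
    ‖(fderiv ℝ f z).comp (ContinuousLinearMap.inl ℝ (Sp n) ℝ)‖ ≤ n * M := by
  refine ContinuousLinearMap.opNorm_le_bound _ (by positivity) fun v => ?_
  have e : (fderiv ℝ f z).comp (ContinuousLinearMap.inl ℝ (Sp n) ℝ) v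
      = ∑ a, v a * dd (sdir n a) f z := by
    simp only [ContinuousLinearMap.comp_apply, ContinuousLinearMap.inl_apply]
    rw [inl_eq_sum, map_sum]
    simp [dd]
  rw [e]
  calc ‖∑ a, v a * dd (sdir n a) f z‖ ≤ ∑ a : Fin n, ‖v‖ * M := by
        refine norm_sum_le_of_le _ fun a _ => ?_
        rw [norm_mul]
        exact mul_le_mul (PiLp.norm_apply_le v a) (h a) (norm_nonneg _) (norm_nonneg _)
    _ = n * M * ‖v‖ := by simp; ring

namespace IsSmoothFlow

variable (hu : IsSmoothFlow u Ω) (hn : 0 < n)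
include hu hn

lemma abs_gradSq_sub_le {x₁ : Sp n} {t₁ s E : ℝ}
    (hs : 0 < s) (hE : 0 < E) (hsE : s ^ 2 * E ≤ 1)
    (hK : closedBall x₁ s ×ˢ Icc (t₁ - s ^ 2) t₁ ⊆ Ω)
    (he : ∀ y ∈ closedBall x₁ s ×ˢ Icc (t₁ - s ^ 2) t₁, gradSq u y ≤ E)
    {t : ℝ} (ht : t ∈ Icc (t₁ - s ^ 2 / 4) t₁) {x y : Sp n} (hx : x ∈ closedBall x₁ (s / 2))
    (hy : y ∈ closedBall x₁ (s / 2)) :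
    |gradSq u (y, t) - gradSq u (x, t)| ≤ lipConst n * E / s * ‖y - x‖ := by
  have hsub : ∀ x ∈ closedBall x₁ (s / 2), (x, t) ∈ closedBall x₁ s ×ˢ Icc (t₁ - s ^ 2) t₁ :=
    fun x hx => ⟨closedBall_subset_closedBall (by linarith) hx,
        Icc_subset_Icc (by nlinarith) le_rfl ht⟩
  refine Convex.norm_image_sub_le_of_norm_hasFDerivWithin_le (f := fun x => gradSq u (x, t))
    (f' := fun x => (fderiv ℝ (gradSq u) (x, t)).comp (ContinuousLinearMap.inl ℝ (Sp n) ℝ))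
    (s := closedBall x₁ (s / 2)) ?_ ?_ (convex_closedBall _ _) hx hy
  · intro x hx
    have h1 := (hu.diff hu.smooth_gradSq (hK (hsub x hx))).hasFDerivAt
    exact (HasFDerivAt.comp (g := gradSq u) (f := fun x => (x, t)) x h1
      (hasFDerivAt_prodMk_left (𝕜 := ℝ) x t)).hasFDerivWithinAt
  · intro x hx
    have h1 : ∀ a, |dd (sdir n a) (gradSq u) (x, t)| ≤ 2 * √(hessConst n) * (E / s) := by
      intro a
      refine abs_le_of_sq_le_sq ?_ (by positivity)
      have h2 := hu.dd_gradSq_sq_le (hK (hsub x hx)) a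
      have h3 := hu.hessSq_le hn hs hE hsE hK he (x, t) ⟨hx, ht⟩
      have h4 : gradSq u (x, t) * hessSq u (x, t) ≤ E * (hessConst n * E / s ^ 2) :=
        mul_le_mul (he _ (hsub x hx)) h3 hessSq_nonneg hE.le
      calc _ ≤ 4 * (E * (hessConst n * E / s ^ 2)) := by linarith
        _ = (2 * √(hessConst n) * (E / s)) ^ 2 := by
          rw [mul_pow, mul_pow, Real.sq_sqrt (hessConst_pos n).le]; ring
    refine (norm_fderiv_inl_le (by positivity) h1).trans ?_
    have : 0 < E / s := by positivity
    rw [lipConst, mul_div_assoc]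
    linarith

lemma exists_half_le_gradSq {x₁ : Sp n} {t₁ s : ℝ} (hs : 0 < s)
    (h0 : 0 < gradSq u (x₁, t₁)) (hsE : s ^ 2 * (4 * gradSq u (x₁, t₁)) ≤ 1)
    (hK : closedBall x₁ s ×ˢ Icc (t₁ - s ^ 2) t₁ ⊆ Ω)
    (he : ∀ y ∈ closedBall x₁ s ×ˢ Icc (t₁ - s ^ 2) t₁, gradSq u y ≤ 4 * gradSq u (x₁, t₁))
    {t : ℝ} (ht : t ∈ Icc (t₁ - s ^ 2 / (16 * (32 * n + 3))) t₁) :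
    ∃ x ∈ closedBall x₁ (s / 4), gradSq u (x₁, t₁) / 2 ≤ gradSq u (x, t) := by
  by_contra! hlt
  set e₁ := gradSq u (x₁, t₁)
  obtain ⟨σ, hσ⟩ : ∃ σ, σ = 1 / s ^ 2 := ⟨_, rfl⟩
  have σ0 : 0 < σ := by rw [hσ]; positivity
  have hσs : σ * s ^ 2 = 1 := by rw [hσ]; field_simp
  have hEσ : 4 * e₁ ≤ σ := by
    rw [hσ, le_div_iff₀ (by positivity)]; linarith
  have ho := hu.isOpen
  have sD : ContDiffOn ℝ (⊤ : ℕ∞) (distSq x₁) Ω := (contDiff_distSq x₁).contDiffOn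
  have sT : ContDiffOn ℝ (⊤ : ℕ∞) (fun y : Sp n × ℝ => y.2) Ω := contDiff_time.contDiffOn
  have hts : t₁ - s ^ 2 ≤ t := by
    refine le_trans ?_ ht.1
    have : s ^ 2 / (16 * (32 * n + 3)) ≤ s ^ 2 := by
      refine div_le_self (by positivity) ?_
      have : (0 : ℝ) ≤ n := Nat.cast_nonneg n
      linarith
    linarith
  have hsub : closedBall x₁ (s / 4) ×ˢ Icc t t₁ ⊆ closedBall x₁ s ×ˢ Icc (t₁ - s ^ 2) t₁ :=
    prod_mono (closedBall_subset_closedBall (by linarith)) (Icc_subset_Icc hts le_rfl)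
  obtain ⟨ν, hν⟩ : ∃ ν, ν = (32 * n + 3) * (4 * e₁) * σ := ⟨_, rfl⟩
  have ν0 : 0 < ν := by rw [hν]; positivity
  have s1 : ContDiffOn ℝ (⊤ : ℕ∞) (fun y => (-(64 * e₁ * σ)) * distSq x₁ y) Ω :=
    contDiffOn_const.mul sD
  have s2 : ContDiffOn ℝ (⊤ : ℕ∞) (fun y : Sp n × ℝ => (-ν) * y.2) Ω :=
    contDiffOn_const.mul sT
  have main := le_of_heatOp_neg
    (f := fun y => gradSq u y + (-(64 * e₁ * σ)) * distSq x₁ y + (-ν) * y.2)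
    (B := e₁ / 2 - ν * t) ho ((hu.smooth_gradSq.add s1).add s2) (hsub.trans hK) ?_ ?_ ?_
    (x₁, t₁) ⟨mem_closedBall_self (by linarith), ht.2, le_rfl⟩
  · simp only [distSq_eq, dist_self] at main
    have h1 : e₁ / 2 ≤ ν * (t₁ - t) := by linarith
    have h2 : ν * (t₁ - t) ≤ ν * (s ^ 2 / (16 * (32 * n + 3))) :=
      mul_le_mul_of_nonneg_left (by linarith [ht.1]) ν0.le
    have h3 : ν * (s ^ 2 / (16 * (32 * n + 3))) = e₁ / 4 * (σ * s ^ 2) := by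
      rw [hν]; field_simp; ring
    rw [hσs] at h3
    linarith
  · intro x hx
    have h1 := hlt x hx
    have h2 : 0 ≤ 64 * e₁ * σ * distSq x₁ (x, t) := by rw [distSq_eq]; positivity
    linarith
  · intro x hx r hr
    have h1 := he (x, r) (hsub ⟨hx.le, hr⟩)
    have h2 : 64 * e₁ * σ * distSq x₁ (x, r) = 4 * e₁ * (σ * s ^ 2) := by
      rw [distSq_eq, hx]; ring
    rw [hσs] at h2
    have h3 := mul_le_mul_of_nonneg_left hr.1 ν0.le
    linarith
  · intro y hy _
    have hyΩ := hK (hsub hy)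
    have h1 := he y (hsub hy)
    rw [heatOp_add ho (hu.smooth_gradSq.add s1) s2 hyΩ, heatOp_add ho hu.smooth_gradSq s1 hyΩ,
      heatOp_const_mul ho _ sD hyΩ, heatOp_const_mul ho _ sT hyΩ, hu.heatOp_gradSq hyΩ,
      heatOp_distSq, heatOp_time]
    have h2 : gradSq u y ^ 2 ≤ 4 * e₁ * σ := by
      rw [pow_two]; exact mul_le_mul h1 (h1.trans hEσ) gradSq_nonneg (by positivity)
    have h3 := hessSq_nonneg (u := u) (z := y)
    have h4 : 0 < e₁ * σ := by positivity
    rw [hν]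
    linarith

/-- Around a point where the energy density is comparable to its maximum over a cylinder, the
density stays comparable on balls at all slightly earlier times. -/
lemma exists_ball_quarter_le_gradSq {x₁ : Sp n} {t₁ s : ℝ} (hs : 0 < s)
    (h0 : 0 < gradSq u (x₁, t₁)) (hsE : s ^ 2 * (4 * gradSq u (x₁, t₁)) ≤ 1)
    (hK : closedBall x₁ s ×ˢ Icc (t₁ - s ^ 2) t₁ ⊆ Ω)
    (he : ∀ y ∈ closedBall x₁ s ×ˢ Icc (t₁ - s ^ 2) t₁, gradSq u y ≤ 4 * gradSq u (x₁, t₁))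
    {t : ℝ} (ht : t ∈ Icc (t₁ - s ^ 2 / (16 * (32 * n + 3))) t₁) :
    ∃ x, ∀ y ∈ closedBall x (s / (16 * lipConst n)),
      gradSq u (x₁, t₁) / 4 ≤ gradSq u (y, t) := by
  obtain ⟨x, hx, hxe⟩ := hu.exists_half_le_gradSq hn hs h0 hsE hK he ht
  have hl := one_le_lipConst n
  have hr : s / (16 * lipConst n) ≤ s / 4 :=
    div_le_div_of_nonneg_left hs.le (by norm_num) (by linarith)
  have ht' : t ∈ Icc (t₁ - s ^ 2 / 4) t₁ := by
    refine ⟨le_trans ?_ ht.1, ht.2⟩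
    have : s ^ 2 / (16 * (32 * n + 3)) ≤ s ^ 2 / 4 :=
      div_le_div_of_nonneg_left (by positivity) (by norm_num)
        (by have : (0 : ℝ) ≤ n := Nat.cast_nonneg n
            linarith)
    linarith
  refine ⟨x, fun y hy => ?_⟩
  have hxd : dist x x₁ ≤ s / 4 := hx
  have hyd : dist y x ≤ s / (16 * lipConst n) := hy
  have h1 := hu.abs_gradSq_sub_le hn hs (by positivity : 0 < 4 * gradSq u (x₁, t₁)) hsE hK he ht'
    (x := x) (y := y) (by rw [mem_closedBall]; linarith)
    (by rw [mem_closedBall]; linarith [dist_triangle y x x₁])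
  rw [← dist_eq_norm] at h1
  have h2 : lipConst n * (4 * gradSq u (x₁, t₁)) / s * dist y x
      ≤ lipConst n * (4 * gradSq u (x₁, t₁)) / s * (s / (16 * lipConst n)) :=
    mul_le_mul_of_nonneg_left hyd (by positivity)
  have h3 : lipConst n * (4 * gradSq u (x₁, t₁)) / s * (s / (16 * lipConst n))
      = gradSq u (x₁, t₁) / 4 := by
    field_simp
    ring
  have := (abs_le.1 h1).1
  linarith

end IsSmoothFlow

end Concentration

section MixedNorm

variable {n k : ℕ} {u : Sp n × ℝ → Fin k → ℝ} {l q : ℝ}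

/-- Volume of the unit ball of `ℝⁿ`. -/
def unitBallVolume (n : ℕ) : ℝ := volume.real (ball (0 : Sp n) 1)

lemma unitBallVolume_pos (n : ℕ) : 0 < unitBallVolume n :=
  ENNReal.toReal_pos (measure_ball_pos _ _ one_pos).ne' measure_ball_lt_top.ne

lemma volume_closedBall_eq (x : Sp n) {ρ : ℝ} (hρ : 0 ≤ ρ) :
    volume (closedBall x ρ) = ENNReal.ofReal (ρ ^ n * unitBallVolume n) := by
  rw [Measure.addHaar_closedBall _ _ hρ, ENNReal.ofReal_mul (by positivity), unitBallVolume,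
    Measure.real, ENNReal.ofReal_toReal measure_ball_lt_top.ne]
  simp

/-- The mixed norm is bounded below if at each time the energy density is at least `e` on some
ball of radius `ρ`. -/
lemma ofReal_le_gradMixedNorm (hl : 0 < l) (hq : 0 < q) {a b α β ρ e : ℝ} (ha : a ≤ α)
    (hb : β ≤ b) (hαβ : α ≤ β) (hρ : 0 ≤ ρ) (he : 0 ≤ e)
    (h : ∀ t ∈ Ioc α β, ∃ x, ∀ y ∈ closedBall x ρ, e ≤ gradSq u (y, t)) :
    ENNReal.ofReal ((ρ ^ n * unitBallVolume n) ^ (1 / l) * (β - α) ^ (1 / q) * √e)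
      ≤ gradMixedNorm u a b l q := by
  have hω := unitBallVolume_pos n
  have inner : ∀ t ∈ Ioc α β, ENNReal.ofReal (e ^ (l / 2) * (ρ ^ n * unitBallVolume n))
      ≤ ∫⁻ x : Sp n, ENNReal.ofReal ((gradSq u (x, t)) ^ (l / 2)) := by
    intro t ht
    obtain ⟨x, hx⟩ := h t ht
    calc ENNReal.ofReal (e ^ (l / 2) * (ρ ^ n * unitBallVolume n))
        = ∫⁻ _ in closedBall x ρ, ENNReal.ofReal (e ^ (l / 2)) := by
          rw [setLIntegral_const, volume_closedBall_eq x hρ, ENNReal.ofReal_mul (by positivity)]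
      _ ≤ ∫⁻ y in closedBall x ρ, ENNReal.ofReal ((gradSq u (y, t)) ^ (l / 2)) := by
          refine setLIntegral_mono' measurableSet_closedBall fun y hy => ?_
          exact ENNReal.ofReal_le_ofReal (Real.rpow_le_rpow he (hx y hy) (by positivity))
      _ ≤ _ := setLIntegral_le_lintegral _ _
  have outer : ENNReal.ofReal (e ^ (l / 2) * (ρ ^ n * unitBallVolume n)) ^ (q / l)
        * ENNReal.ofReal (β - α)
      ≤ ∫⁻ t in Ioc a b,
        (∫⁻ x : Sp n, ENNReal.ofReal ((gradSq u (x, t)) ^ (l / 2))) ^ (q / l) := by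
    rw [← Real.volume_Ioc, ← setLIntegral_const]
    refine (setLIntegral_mono' measurableSet_Ioc fun t ht => ?_).trans
      (lintegral_mono_set (Ioc_subset_Ioc ha hb))
    exact ENNReal.rpow_le_rpow (inner t ht) (by positivity)
  refine le_trans (le_of_eq ?_) (ENNReal.rpow_le_rpow outer (by positivity : 0 ≤ 1 / q))
  have h1 : q / l * (1 / q) = 1 / l := by field_simp
  have h2 : (e ^ (l / 2)) ^ (1 / l) = √e := by
    rw [← Real.rpow_mul he, Real.sqrt_eq_rpow]
    congr 1
    field_simp
  have h3 : 0 ≤ β - α := by linarith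
  rw [ENNReal.mul_rpow_of_nonneg _ _ (by positivity), ← ENNReal.rpow_mul, h1,
    ENNReal.ofReal_rpow_of_nonneg (by positivity) (by positivity),
    ENNReal.ofReal_rpow_of_nonneg h3 (by positivity), ← ENNReal.ofReal_mul (by positivity),
    Real.mul_rpow (x := e ^ (l / 2)) (by positivity) (by positivity), h2]
  congr 1
  ring

lemma exists_gradMixedNorm_le (hq : 0 < q) {T ε : ℝ} (hT : 0 < T) (hε : 0 < ε)
    (h : gradMixedNorm u 0 T l q < ⊤) :
    ∃ τ, 0 < τ ∧ τ < T ∧ gradMixedNorm u 0 τ l q ≤ ENNReal.ofReal ε := by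
  have hI := ((ENNReal.rpow_lt_top_iff_of_pos (by positivity : 0 < 1 / q)).1 h).ne
  have hμ : Tendsto ((volume.restrict (Ioc 0 T)) ∘ fun τ : ℝ => Ioc 0 τ)
      (nhdsWithin 0 (Ioi 0)) (nhds 0) := by
    have h0 : Tendsto (fun τ : ℝ => ENNReal.ofReal τ) (nhdsWithin 0 (Ioi 0)) (nhds 0) := by
      have := (ENNReal.continuous_ofReal.tendsto 0).mono_left
        (nhdsWithin_le_nhds (s := Ioi (0 : ℝ)))
      rwa [ENNReal.ofReal_zero] at this
    refine tendsto_of_tendsto_of_tendsto_of_le_of_le tendsto_const_nhds h0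
      (fun _ => zero_le) fun τ => ?_
    refine (Measure.restrict_apply_le _ _).trans ?_
    simp
  have ht := tendsto_setLIntegral_zero hI hμ
  have hε' : 0 < ENNReal.ofReal ε ^ q :=
    ENNReal.rpow_pos (ENNReal.ofReal_pos.2 hε) ENNReal.ofReal_ne_top
  obtain ⟨τ, h1, h2⟩ := ((ht.eventually_le_const hε').and (Ioo_mem_nhdsGT hT)).exists
  refine ⟨τ, h2.1, h2.2, ?_⟩
  rw [Measure.restrict_restrict measurableSet_Ioc,
    inter_eq_left.2 (Ioc_subset_Ioc le_rfl h2.2.le)] at h1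
  refine (ENNReal.rpow_le_rpow h1 (by positivity : 0 ≤ 1 / q)).trans_eq ?_
  rw [← ENNReal.rpow_mul, mul_one_div_cancel hq.ne', ENNReal.rpow_one]

end MixedNorm

section GradientBound

variable {n k : ℕ} {Ω : Set (Sp n × ℝ)} {u : Sp n × ℝ → Fin k → ℝ} {l q : ℝ}

/-- Constant in the concentration estimate for the mixed norm. -/
def concConst (n : ℕ) (l q : ℝ) : ℝ :=
  ((1 / (16 * lipConst n)) ^ n * unitBallVolume n) ^ (1 / l)
    * (1 / (16 * (32 * n + 3))) ^ (1 / q) / 2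

lemma concConst_pos (n : ℕ) (l q : ℝ) : 0 < concConst n l q := by
  have h1 := unitBallVolume_pos n
  have h2 := one_le_lipConst n
  unfold concConst
  positivity

namespace IsSmoothFlow

variable (hu : IsSmoothFlow u Ω) (hn : 0 < n)
include hu hn

lemma concConst_le_gradMixedNorm (hl : 0 < l) (hq : 0 < q) (hlq : (n : ℝ) / l + 2 / q = 1)
    {x₁ : Sp n} {t₁ s a b : ℝ} (hs : 0 < s)
    (h0 : 0 < gradSq u (x₁, t₁)) (hsE : s ^ 2 * (4 * gradSq u (x₁, t₁)) ≤ 1)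
    (hK : closedBall x₁ s ×ˢ Icc (t₁ - s ^ 2) t₁ ⊆ Ω)
    (he : ∀ y ∈ closedBall x₁ s ×ˢ Icc (t₁ - s ^ 2) t₁, gradSq u y ≤ 4 * gradSq u (x₁, t₁))
    (ha : a ≤ t₁ - s ^ 2) (hb : t₁ ≤ b) :
    ENNReal.ofReal (concConst n l q * (s * √(gradSq u (x₁, t₁)))) ≤ gradMixedNorm u a b l q := by
  have hL := one_le_lipConst n
  have hω := unitBallVolume_pos n
  have hτ : s ^ 2 / (16 * (32 * n + 3)) ≤ s ^ 2 := by
    refine div_le_self (by positivity) ?_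
    have : (0 : ℝ) ≤ n := Nat.cast_nonneg n
    linarith
  have hτ0 : 0 ≤ s ^ 2 / (16 * (32 * n + 3)) := by positivity
  refine le_trans (le_of_eq ?_) (ofReal_le_gradMixedNorm (u := u) (l := l) (q := q)
    (a := a) (b := b) (α := t₁ - s ^ 2 / (16 * (32 * n + 3))) (β := t₁)
    (ρ := s / (16 * lipConst n)) (e := gradSq u (x₁, t₁) / 4)
    hl hq (by linarith) hb (by linarith) (by positivity) (by positivity)
    fun t ht => hu.exists_ball_quarter_le_gradSq hn hs h0 hsE hK he (Ioc_subset_Icc_self ht))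
  have h1 : ((s / (16 * lipConst n)) ^ n * unitBallVolume n) ^ (1 / l)
      = s ^ ((n : ℝ) / l) * ((1 / (16 * lipConst n)) ^ n * unitBallVolume n) ^ (1 / l) := by
    have : (s / (16 * lipConst n)) ^ n * unitBallVolume n
        = s ^ n * ((1 / (16 * lipConst n)) ^ n * unitBallVolume n) := by
      rw [div_eq_mul_one_div, mul_pow]; ring
    rw [this, Real.mul_rpow (by positivity) (by positivity), ← Real.rpow_natCast s n,
      ← Real.rpow_mul hs.le, mul_one_div]
  have h2 : (t₁ - (t₁ - s ^ 2 / (16 * (32 * n + 3)))) ^ (1 / q)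
      = s ^ (2 / q) * (1 / (16 * (32 * n + 3))) ^ (1 / q) := by
    have : t₁ - (t₁ - s ^ 2 / (16 * (32 * n + 3))) = s ^ 2 * (1 / (16 * (32 * n + 3))) := by ring
    rw [this, Real.mul_rpow (by positivity) (by positivity), ← Real.rpow_natCast s 2,
      ← Real.rpow_mul hs.le, mul_one_div]
    norm_num
  have h3 : √(gradSq u (x₁, t₁) / 4) = √(gradSq u (x₁, t₁)) / 2 := by
    rw [Real.sqrt_div' _ (by norm_num), show (4 : ℝ) = 2 ^ 2 by norm_num,
      Real.sqrt_sq (by norm_num)]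
  have h4 : s ^ ((n : ℝ) / l) * s ^ (2 / q) = s := by
    rw [← Real.rpow_add hs, hlq, Real.rpow_one]
  rw [h1, h2, h3, concConst]
  congr 1
  calc _ = s * (((1 / (16 * lipConst n)) ^ n * unitBallVolume n) ^ (1 / l)
        * (1 / (16 * (32 * n + 3))) ^ (1 / q) / 2) * √(gradSq u (x₁, t₁)) := by ring
    _ = _ := by
      nth_rewrite 1 [← h4]
      ring

/-- Small mixed norm controls the gradient at the top of a parabolic cylinder. -/
lemma mul_sqrt_gradSq_le (hl : 0 < l) (hq : 0 < q) (hlq : (n : ℝ) / l + 2 / q = 1)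
    {x₀ : Sp n} {t₀ r a b N : ℝ} (hr : 0 < r)
    (hK : closedBall x₀ r ×ˢ Icc (t₀ - r ^ 2) t₀ ⊆ Ω) (ha : a ≤ t₀ - r ^ 2) (hb : t₀ ≤ b)
    (hN0 : 0 ≤ N) (hN : gradMixedNorm u a b l q ≤ ENNReal.ofReal N)
    (hNc : N ≤ concConst n l q / 4) :
    r * √(gradSq u (x₀, t₀)) ≤ 2 * N / concConst n l q := by
  have hc := concConst_pos n l q
  rcases (gradSq_nonneg (u := u) (z := (x₀, t₀))).eq_or_lt with h0 | h0
  · rw [← h0, Real.sqrt_zero, mul_zero]; positivity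
  set K := closedBall x₀ r ×ˢ Icc (t₀ - r ^ 2) t₀ with hKdef
  obtain ⟨d, hd⟩ : ∃ d : Sp n × ℝ → ℝ, d = fun z => r - max (dist z.1 x₀) √(t₀ - z.2) := ⟨_, rfl⟩
  have dcont : Continuous d := by rw [hd]; fun_prop
  have d0 : d (x₀, t₀) = r := by simp [hd]
  have hz₀ : (x₀, t₀) ∈ K := ⟨mem_closedBall_self hr.le, by nlinarith, le_rfl⟩
  have memK : ∀ z : Sp n × ℝ, 0 ≤ d z → z.2 ≤ t₀ → z ∈ K := by
    intro z hz hzt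
    simp only [hd, sub_nonneg, max_le_iff] at hz
    have := (Real.sqrt_le_left hr.le).1 hz.2
    exact ⟨hz.1, by linarith, hzt⟩
  have dnn : ∀ z ∈ K, 0 ≤ d z := by
    rintro z ⟨h1, h2⟩
    simp only [hd, sub_nonneg, max_le_iff]
    exact ⟨h1, (Real.sqrt_le_left hr.le).2 (by linarith [h2.1])⟩
  obtain ⟨⟨x₁, t₁⟩, hz₁, hmax⟩ :=
    ((isCompact_closedBall x₀ r).prod isCompact_Icc).exists_isMaxOn ⟨_, hz₀⟩
      ((dcont.pow 2).continuousOn.mul (hu.smooth_gradSq.continuousOn.mono hK))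
  have hmax' : ∀ z ∈ K, d z ^ 2 * gradSq u z ≤ d (x₁, t₁) ^ 2 * gradSq u (x₁, t₁) :=
    fun z hz => hmax hz
  have e1 := gradSq_nonneg (u := u) (z := (x₁, t₁))
  have hm0 := hmax' _ hz₀
  rw [d0] at hm0
  have hpos : 0 < d (x₁, t₁) ^ 2 * gradSq u (x₁, t₁) := lt_of_lt_of_le (by positivity) hm0
  have hd1 : 0 < d (x₁, t₁) := (dnn _ hz₁).lt_of_ne' fun h => by simp [h] at hpos
  have he1 : 0 < gradSq u (x₁, t₁) := e1.lt_of_ne' fun h => by simp [h] at hpos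
  have hse : 0 < √(gradSq u (x₁, t₁)) := Real.sqrt_pos.2 he1
  obtain ⟨s, hs⟩ : ∃ s, s = min (d (x₁, t₁) / 2) (1 / (2 * √(gradSq u (x₁, t₁)))) := ⟨_, rfl⟩
  have hs0 : 0 < s := by rw [hs]; positivity
  have hs1 : s ≤ d (x₁, t₁) / 2 := by rw [hs]; exact min_le_left _ _
  have hs2 : s ≤ 1 / (2 * √(gradSq u (x₁, t₁))) := by rw [hs]; exact min_le_right _ _
  have hsE : s ^ 2 * (4 * gradSq u (x₁, t₁)) ≤ 1 := by
    have h1 : s * (2 * √(gradSq u (x₁, t₁))) ≤ 1 := (le_div_iff₀ (by positivity)).1 hs2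
    have h2 := pow_le_one₀ (n := 2) (by positivity) h1
    rw [mul_pow, mul_pow, Real.sq_sqrt e1] at h2
    linarith
  have hdz : ∀ z ∈ closedBall x₁ s ×ˢ Icc (t₁ - s ^ 2) t₁, d (x₁, t₁) / 2 ≤ d z := by
    rintro z ⟨h1, h2⟩
    have h3 : dist z.1 x₀ ≤ dist x₁ x₀ + s := by
      have h1' : dist z.1 x₁ ≤ s := h1
      linarith [dist_triangle z.1 x₁ x₀]
    have h4 : √(t₀ - z.2) ≤ √(t₀ - t₁) + s := by
      refine Real.sqrt_le_iff.2 ⟨by positivity, ?_⟩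
      have h5 := Real.sq_sqrt (sub_nonneg.2 hz₁.2.2)
      have h6 : 0 ≤ √(t₀ - t₁) * s := by positivity
      nlinarith [h2.1]
    have h7 : max (dist z.1 x₀) √(t₀ - z.2) ≤ max (dist x₁ x₀) √(t₀ - t₁) + s :=
      max_le (h3.trans (by gcongr; exact le_max_left _ _))
        (h4.trans (by gcongr; exact le_max_right _ _))
    have h8 : d z = r - max (dist z.1 x₀) √(t₀ - z.2) := by rw [hd]
    have h9 : d (x₁, t₁) = r - max (dist x₁ x₀) √(t₀ - t₁) := by rw [hd]
    linarith
  have hsub : closedBall x₁ s ×ˢ Icc (t₁ - s ^ 2) t₁ ⊆ K := fun z hz =>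
    memK z (by linarith [hdz z hz]) (hz.2.2.trans hz₁.2.2)
  have he : ∀ z ∈ closedBall x₁ s ×ˢ Icc (t₁ - s ^ 2) t₁,
      gradSq u z ≤ 4 * gradSq u (x₁, t₁) := by
    intro z hz
    have h1 := hmax' z (hsub hz)
    have h2 : (d (x₁, t₁) / 2) ^ 2 * gradSq u z ≤ d z ^ 2 * gradSq u z :=
      mul_le_mul_of_nonneg_right (pow_le_pow_left₀ (by positivity) (hdz z hz) 2) gradSq_nonneg
    refine le_of_mul_le_mul_left (a := (d (x₁, t₁) / 2) ^ 2) ?_ (by positivity)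
    linarith
  have hbot : (x₁, t₁ - s ^ 2) ∈ K :=
    hsub ⟨mem_closedBall_self hs0.le, le_rfl, by linarith [sq_nonneg s]⟩
  have hlow := (hu.concConst_le_gradMixedNorm hn hl hq hlq hs0 he1 hsE (hsub.trans hK) he
    (ha.trans hbot.2.1) (hz₁.2.2.trans hb)).trans hN
  rw [ENNReal.ofReal_le_ofReal_iff hN0] at hlow
  have hsd : s = d (x₁, t₁) / 2 := by
    rcases min_choice (d (x₁, t₁) / 2) (1 / (2 * √(gradSq u (x₁, t₁)))) with h | h
    · rw [hs, h]
    · exfalso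
      have h1 : s * √(gradSq u (x₁, t₁)) = 1 / 2 := by
        rw [hs, h]; field_simp
      rw [h1] at hlow
      linarith
  have hfin : r * √(gradSq u (x₀, t₀)) ≤ d (x₁, t₁) * √(gradSq u (x₁, t₁)) := by
    refine le_of_sq_le_sq ?_ (by positivity)
    rw [mul_pow, mul_pow, Real.sq_sqrt e1, Real.sq_sqrt h0.le]
    exact hm0
  rw [le_div_iff₀ hc]
  rw [hsd] at hlow
  have := mul_le_mul_of_nonneg_right hfin hc.le
  linarith

end IsSmoothFlow

end GradientBound

lemma isSmoothFlow_of_heatFlow {n k : ℕ} {T : ℝ} {u : Sp n × ℝ → Fin k → ℝ}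
    (hS : SphereValued u {z : Sp n × ℝ | z.2 ∈ Icc 0 T})
    (hC : ContDiffOn ℝ (⊤ : ℕ∞) u {z : Sp n × ℝ | z.2 ∈ Ioc 0 T})
    (hF : HeatFlow u {z : Sp n × ℝ | z.2 ∈ Ioc 0 T}) :
    IsSmoothFlow u {z : Sp n × ℝ | z.2 ∈ Ioo 0 T} where
  isOpen := isOpen_Ioo.preimage continuous_snd
  smooth := contDiffOn_pi.1 (hC.mono fun _ hz => Ioo_subset_Ioc_self hz)
  sphere z hz := hS z (Ioo_subset_Icc_self hz)
  flow z hz i := by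
    have h := hF z (Ioo_subset_Ioc_self hz) i
    have e : heatOp (fun z => u z i) z = pd u i (tdir n) z - lap u i z := rfl
    rw [e]
    linarith

/-- Lemma 4.3 of the paper (case M = ℝⁿ, N = S^{k-1}): blow-up rate of the gradient near the
initial time for Serrin-class solutions, and its vanishing as `t → 0⁺`. -/
theorem serrin_blow_up_rate_heat_flow_sphere
    (n k : ℕ) (hn : 2 ≤ n) (hk : 2 ≤ k)
    (l q : ℝ) (hl : (n : ℝ) < l) (hq : 2 < q) (hlq : (n : ℝ) / l + 2 / q = 1) :
    ∃ C : ℝ, 0 < C ∧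
      ∀ (T : ℝ), 0 < T →
      ∀ u : Sp n × ℝ → Fin k → ℝ,
        ContinuousOn u {z : Sp n × ℝ | z.2 ∈ Icc 0 T} →
        SphereValued u {z : Sp n × ℝ | z.2 ∈ Icc 0 T} →
        ContDiffOn ℝ (⊤ : ℕ∞) u {z : Sp n × ℝ | z.2 ∈ Ioc 0 T} →
        HeatFlow u {z : Sp n × ℝ | z.2 ∈ Ioc 0 T} →
        gradMixedNorm u 0 T l q < ⊤ →
        (∃ t₀ : ℝ, 0 < t₀ ∧ t₀ ≤ T ∧
          ∀ t : ℝ, 0 < t → t ≤ t₀ → ∀ x : Sp n,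
            Real.sqrt t * Real.sqrt (gradSq u (x, t))
              ≤ C * (gradMixedNorm u 0 t₀ l q).toReal) ∧
        (∀ δ : ℝ, 0 < δ → ∃ τ : ℝ, 0 < τ ∧
          ∀ t : ℝ, 0 < t → t < τ → t ≤ T → ∀ x : Sp n,
            Real.sqrt t * Real.sqrt (gradSq u (x, t)) ≤ δ) := by
  have hn0 : 0 < n := by omega
  have hq0 : 0 < q := by linarith
  have hl0 : 0 < l := lt_of_le_of_lt (Nat.cast_nonneg n) hl
  have hc := concConst_pos n l q
  refine ⟨4 / concConst n l q, by positivity, fun T hT u _ hS hC hF hfin => ?_⟩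
  have hu := isSmoothFlow_of_heatFlow hS hC hF
  have key : ∀ τ N : ℝ, τ < T → 0 ≤ N → gradMixedNorm u 0 τ l q ≤ ENNReal.ofReal N →
      N ≤ concConst n l q / 4 → ∀ t : ℝ, 0 < t → t ≤ τ → ∀ x : Sp n,
        √t * √(gradSq u (x, t)) ≤ 4 / concConst n l q * N := by
    intro τ N hτ hN0 hN hNc t ht htτ x
    have hr : 0 < √t / 2 := by positivity
    have hr2 : (√t / 2) ^ 2 = t / 4 := by
      rw [div_pow, Real.sq_sqrt ht.le]; norm_num
    have h := hu.mul_sqrt_gradSq_le hn0 hl0 hq0 hlq (x₀ := x) (t₀ := t) (a := 0) (b := τ) hr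
      (fun z hz => ⟨by linarith [hz.2.1], by linarith [hz.2.2]⟩) (by linarith) htτ hN0 hN hNc
    have h2 : 4 / concConst n l q * N = 2 * (2 * N / concConst n l q) := by ring
    linarith
  refine ⟨?_, fun δ hδ => ?_⟩
  · obtain ⟨τ, h0, h1, h2⟩ := exists_gradMixedNorm_le hq0 hT
      (by positivity : 0 < concConst n l q / 4) hfin
    have hN := (ENNReal.ofReal_toReal (h2.trans_lt ENNReal.ofReal_lt_top).ne).ge
    exact ⟨τ, h0, h1.le, key τ _ h1 ENNReal.toReal_nonneg hN
      (ENNReal.toReal_le_of_le_ofReal (by positivity) h2)⟩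
  · obtain ⟨τ, h0, h1, h2⟩ := exists_gradMixedNorm_le hq0 hT
      (by positivity : 0 < min (concConst n l q / 4) (concConst n l q / 4 * δ)) hfin
    refine ⟨τ, h0, fun t ht htτ _ x => ?_⟩
    refine (key τ _ h1 (by positivity) h2 (min_le_left _ _) t ht htτ.le x).trans ?_
    refine (mul_le_mul_of_nonneg_left (min_le_right _ _) (by positivity)).trans_eq ?_
    field_simp
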